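/- arXiv:1407.4216 — 2 statements merged into one kernel-verified Lean document; each statement's English description precedes it below -/
import Mathlib

section
/- If d₁ = 1, d₂, ..., d_r are real algebraic numbers linearly independent over ℚ, then the elements of the set {d_j · log p : p prime, 1 ≤ j ≤ r} are linearly independent over ℚ. -/
open NumberField Module

lemma baker_div_one (f : ℂ → ℂ) (hf : Differentiable ℂ f) (a : ℂ) (S : ℕ)
    (h : (S : ℕ∞) ≤ analyticOrderAt f a) :
    ∃ g : ℂ → ℂ, Differentiable ℂ g ∧ ∀ z, f z = (z - a) ^ S * g z := by
  induction S generalizing f with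
  | zero => exact ⟨f, hf, by simp⟩
  | succ S ih =>
    have hfa : f a = 0 := by
      apply apply_eq_zero_of_analyticOrderAt_ne_zero
      intro h0
      rw [h0] at h
      simp at h
    have hd : Differentiable ℂ (dslope f a) := by
      rw [← differentiableOn_univ]
      rw [Complex.differentiableOn_dslope Filter.univ_mem]
      exact hf.differentiableOn
    have hfe : f = (fun z => z - a) * dslope f a := by
      funext z
      have := sub_smul_dslope f a z
      simp [hfa] at this
      simp [this]
    have hS : (S : ℕ∞) ≤ analyticOrderAt (dslope f a) a := by
      have h1 : analyticOrderAt f a = 1 + analyticOrderAt (dslope f a) a := by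
        conv_lhs => rw [hfe]
        rw [analyticOrderAt_mul (by fun_prop) (hd.analyticAt a)]
        congr 1
        simp
      rw [h1] at h
      push_cast at h
      rw [add_comm] at h
      exact (ENat.add_le_add_iff_left (by simp)).1 h
    obtain ⟨g, hg, hg2⟩ := ih _ hd hS
    refine ⟨g, hg, fun z => ?_⟩
    conv_lhs => rw [hfe]
    simp only [Pi.mul_apply, hg2]
    ring

lemma baker_div (s : Finset ℂ) (f : ℂ → ℂ) (hf : Differentiable ℂ f) (S : ℕ)
    (h : ∀ a ∈ s, (S : ℕ∞) ≤ analyticOrderAt f a) :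
    ∃ g : ℂ → ℂ, Differentiable ℂ g ∧ ∀ z, f z = (∏ a ∈ s, (z - a)) ^ S * g z := by
  classical
  induction s using Finset.induction_on with
  | empty => exact ⟨f, hf, by simp⟩
  | insert a s ha ih =>
    obtain ⟨g, hg, hg2⟩ := ih (fun b hb => h b (Finset.mem_insert_of_mem hb))
    have hS : (S : ℕ∞) ≤ analyticOrderAt g a := by
      have h1 := h a (Finset.mem_insert_self _ _)
      have hfe : f = (fun z => (∏ a ∈ s, (z - a)) ^ S) * g := by
        funext z; simp [hg2]
      have hp : AnalyticAt ℂ (fun z => (∏ a ∈ s, (z - a)) ^ S) a :=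
        Differentiable.analyticAt (by fun_prop) a
      rw [hfe, analyticOrderAt_mul hp (hg.analyticAt a)] at h1
      have h0 : analyticOrderAt (fun z => (∏ a ∈ s, (z - a)) ^ S) a = 0 := by
        rw [hp.analyticOrderAt_eq_zero]
        apply pow_ne_zero
        rw [Finset.prod_ne_zero_iff]
        intro b hb
        rw [sub_ne_zero]
        rintro rfl
        exact ha hb
      rwa [h0, zero_add] at h1
    obtain ⟨k, hk, hk2⟩ := baker_div_one g hg a S hS
    refine ⟨k, hk, fun z => ?_⟩
    rw [hg2, hk2, Finset.prod_insert ha, mul_pow]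
    ring

lemma baker_schwarz (f : ℂ → ℂ) (hf : Differentiable ℂ f) (R R' S : ℕ) (hRR : R ≤ R') (B : ℝ)
    (hz : ∀ l < R, ∀ j < S, iteratedDeriv j f (l : ℂ) = 0)
    (hB : ∀ z : ℂ, ‖z‖ ≤ 3 * R' → ‖f z‖ ≤ B) (x : ℕ) (hx : x < R') :
    ‖f x‖ ≤ B * (1 / 2) ^ (S * R) := by
  classical
  have hR' : (0 : ℝ) < R' := by exact_mod_cast (by omega : 0 < R')
  obtain ⟨g, hg, hfg⟩ := baker_div ((Finset.range R).image (fun l : ℕ => (l : ℂ))) f hf S (by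
    intro a ha
    simp only [Finset.mem_image, Finset.mem_range] at ha
    obtain ⟨l, hl, rfl⟩ := ha
    rw [natCast_le_analyticOrderAt_iff_iteratedDeriv_eq_zero (hf.analyticAt _)]
    exact hz l hl)
  have hfg' : ∀ z, f z = (∏ l ∈ Finset.range R, (z - (l : ℂ))) ^ S * g z := by
    intro z
    rw [hfg, Finset.prod_image (by intro a _ b _ h; exact Nat.cast_injective h)]
  have hgb : ‖g x‖ ≤ B / (2 * R') ^ (R * S) := by
    apply Complex.norm_le_of_forall_mem_frontier_norm_le (U := Metric.ball (0 : ℂ) (3 * R'))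
      Metric.isBounded_ball hg.diffContOnCl
    · intro z hzf
      rw [frontier_ball _ (by positivity)] at hzf
      have hzn : ‖z‖ = 3 * R' := by simpa using hzf
      rw [le_div_iff₀ (by positivity), mul_comm]
      refine le_trans ?_ (hB z hzn.le)
      rw [hfg' z, norm_mul, norm_pow, norm_prod, pow_mul]
      gcongr
      rw [← Finset.card_range R, ← Finset.prod_const, Finset.card_range]
      apply Finset.prod_le_prod
      · intros; positivity
      · intro l hl
        have hl' : (l : ℝ) ≤ R' := by exact_mod_cast (Finset.mem_range.1 hl).le.trans hRR
        have := norm_sub_norm_le z (l : ℂ)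
        rw [hzn, Complex.norm_natCast] at this
        linarith
    · apply subset_closure
      simp only [Metric.mem_ball, dist_zero_right, Complex.norm_natCast]
      have : (x : ℝ) < R' := by exact_mod_cast hx
      linarith
  have hB0 : 0 ≤ B := le_trans (norm_nonneg _) (hB 0 (by simp))
  rw [hfg' x, norm_mul, norm_pow, norm_prod]
  calc (∏ l ∈ Finset.range R, ‖(x : ℂ) - l‖) ^ S * ‖g x‖
      ≤ ((R' : ℝ) ^ R) ^ S * (B / (2 * R') ^ (R * S)) := by
        gcongr
        rw [← Finset.card_range R, ← Finset.prod_const, Finset.card_range]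
        apply Finset.prod_le_prod
        · intros; positivity
        · intro l hl
          have hl' : (l : ℝ) ≤ R' := by exact_mod_cast (Finset.mem_range.1 hl).le.trans hRR
          have hx' : (x : ℝ) ≤ R' := by exact_mod_cast hx.le
          have : (x : ℂ) - l = (((x : ℝ) - l : ℝ) : ℂ) := by push_cast; rfl
          rw [this, Complex.norm_real, Real.norm_eq_abs, abs_le]
          have h1 : (0 : ℝ) ≤ x := by positivity
          have h2 : (0 : ℝ) ≤ l := by positivity
          constructor <;> linarith
    _ = B * (1 / 2) ^ (S * R) := by
        rw [← pow_mul, mul_pow, mul_comm S R, div_pow, one_pow]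
        field_simp

lemma baker_liouville (K : Type*) [Field K] [NumberField K] (σ : K →+* ℂ) (x : 𝓞 K) (hx : x ≠ 0)
    (B : ℝ) (hB : house (x : K) ≤ B) (hB1 : 1 ≤ B) :
    1 ≤ ‖σ x‖ * B ^ (finrank ℚ K) := by
  have h1 := norm_norm_le_norm_mul_house_pow (x : K) σ
  have h2 : (1 : ℝ) ≤ ‖Algebra.norm ℚ (x : K)‖ := by
    have h3 : Algebra.norm ℤ x ≠ 0 := by
      rwa [Algebra.norm_ne_zero_iff]
    have h4 : Algebra.norm ℚ (x : K) = ((Algebra.norm ℤ x : ℤ) : ℚ) :=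
      (Algebra.coe_norm_int x).symm
    rw [h4]
    have h5 : (1 : ℤ) ≤ |Algebra.norm ℤ x| := Int.one_le_abs h3
    have : ‖((Algebra.norm ℤ x : ℤ) : ℚ)‖ = |((Algebra.norm ℤ x : ℤ) : ℝ)| := by
      rw [← Rat.norm_cast_real]; simp
    rw [this]
    exact_mod_cast h5
  refine h2.trans (h1.trans ?_)
  gcongr
  calc house (x : K) ^ (finrank ℚ K - 1) ≤ B ^ (finrank ℚ K - 1) := by
        gcongr; exact house_nonneg _
    _ ≤ B ^ finrank ℚ K := pow_le_pow_right₀ hB1 (Nat.sub_le _ _)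

lemma baker_siegel (K : Type*) [Field K] [NumberField K] :
    ∃ C : ℝ, 1 ≤ C ∧ ∀ (α β : Type) [Fintype α] [Fintype β] (a : Matrix α β (𝓞 K)) (A : ℝ),
      a ≠ 0 → 1 ≤ A → (∀ k l, house ((a k l : 𝓞 K) : K) ≤ A) → 0 < Fintype.card α →
      2 * Fintype.card α ≤ Fintype.card β →
      ∃ ξ : β → 𝓞 K, ξ ≠ 0 ∧ a.mulVec ξ = 0 ∧
        ∀ l, house (ξ l : K) ≤ C * (C * Fintype.card β * A) := by
  classical
  have key : ∃ C : ℝ, ∀ (α β : Type) [Fintype α] [Fintype β] (a : Matrix α β (𝓞 K)) (A : ℝ),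
      a ≠ 0 → (∀ k l, house (algebraMap (𝓞 K) K (a k l)) ≤ A) → 0 < Fintype.card α →
      Fintype.card α < Fintype.card β →
      ∃ ξ : β → 𝓞 K, ξ ≠ 0 ∧ a.mulVec ξ = 0 ∧
        ∀ l, house (ξ l).1 ≤ C * ((C * (Fintype.card β : ℕ) * A) ^
          (((Fintype.card α : ℕ) : ℝ) / ((Fintype.card β : ℕ) - (Fintype.card α : ℕ)))) := by
    refine ⟨?_, ?_⟩
    rotate_left
    · intro α β _ _ a A ha hA h0 h1
      exact house.exists_ne_zero_int_vec_house_le K a ha h0 h1 rfl hA rfl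
  obtain ⟨C, hC⟩ := key
  refine ⟨max 1 |C|, le_max_left _ _, ?_⟩
  intro α β _ _ a A ha hA1 hA h0 h1
  obtain ⟨ξ, h2, h3, h4⟩ := hC α β a A ha hA h0 (by omega)
  refine ⟨ξ, h2, h3, fun l => (h4 l).trans ?_⟩
  set p := Fintype.card α
  set q := Fintype.card β
  have hq : (1 : ℝ) ≤ q := by exact_mod_cast (by omega : 1 ≤ q)
  have hpq : (2 * p : ℝ) ≤ q := by exact_mod_cast h1
  have hp : (0 : ℝ) < p := by exact_mod_cast h0
  set M := max 1 |C|
  have hM : 1 ≤ M := le_max_left _ _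
  have hM2 : |C| ≤ M := le_max_right _ _
  have hb : 1 ≤ M * q * A := by
    have := one_le_mul_of_one_le_of_one_le hM hq
    exact one_le_mul_of_one_le_of_one_le this hA1
  refine (le_abs_self _).trans ?_
  rw [abs_mul]
  gcongr
  refine (Real.abs_rpow_le_abs_rpow _ _).trans ?_
  have he : (p : ℝ) / (q - p) ≤ 1 := by
    rw [div_le_one (by linarith)]; linarith
  have he0 : 0 ≤ (p : ℝ) / (q - p) := div_nonneg hp.le (by linarith)
  calc |C * q * A| ^ ((p : ℝ) / (q - p)) ≤ (M * q * A) ^ ((p : ℝ) / (q - p)) := by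
        apply Real.rpow_le_rpow (abs_nonneg _) _ he0
        rw [abs_mul, abs_mul, abs_of_nonneg (by linarith : (0 : ℝ) ≤ q),
          abs_of_nonneg (by linarith : (0 : ℝ) ≤ A)]
        gcongr
    _ ≤ (M * q * A) ^ (1 : ℝ) := Real.rpow_le_rpow_of_exponent_le hb he
    _ = M * q * A := Real.rpow_one _

lemma baker_vandermonde {R : Type*} [CommRing R] [IsDomain R] {Λ : Type*} [Fintype Λ]
    (v : Λ → R) (hv : Function.Injective v) (c : Λ → R)
    (h : ∀ l < Fintype.card Λ, ∑ i, c i * v i ^ l = 0) : c = 0 := by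
  classical
  let e := Fintype.equivFin Λ
  have := Matrix.eq_zero_of_forall_pow_sum_mul_pow_eq_zero (R := R) (f := v ∘ e.symm)
    (v := c ∘ e.symm) (hv.comp e.symm.injective) (by
      intro i
      rw [← h i i.2, ← e.symm.sum_comp]
      rfl)
  funext i
  simpa using congrFun this (e i)

set_option maxHeartbeats 1000000 in
lemma baker_asymp (k D : ℕ) (W C : ℝ) (hW : 1 ≤ W) (hC : 1 ≤ C) (T : ℕ) :
    ∃ g : ℕ, 2 ^ (T + 1) ≤ g ∧ ∀ J < T, ∀ L : ℝ, L = 2 ^ (T + 1) * (g : ℝ) ^ (4 * k + 2) →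
      (L ^ (k + 1) * (C * (C * L ^ (k + 1) * ((W * L) ^ ((k + 1) * (2 ^ T * g ^ (4 * k + 4))) *
        Real.exp (W * L * (g : ℝ) ^ (2 * k + 2)))) * (W * L) ^ (2 ^ T * g ^ (4 * k + 4)) *
        Real.exp (W * L * (3 * (g : ℝ) ^ (2 * k + 2 + (J + 1)))))) ^ (D + 1) *
      (1 / 2 : ℝ) ^ ((2 ^ (T - (J + 1)) * g ^ (4 * k + 4)) * g ^ (2 * k + 2 + J)) < 1 := by
  set u : ℝ := 2 ^ (T + 1) with hu
  have hu1 : 1 ≤ u := one_le_pow₀ (by norm_num)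
  set a : ℝ := W * u + (4 * k + 2) with ha
  set c : ℝ := 2 * (a * (k + 1)) + 2 * C + (k + 1) * (a * u) + W * u + a * u + 3 * (W * u) with hc
  obtain ⟨g, hg⟩ := exists_nat_gt (max (2 * (D + 1) * c) u)
  have hgc : 2 * (D + 1) * c < g := (le_max_left _ _).trans_lt hg
  have hgu : u < g := (le_max_right _ _).trans_lt hg
  have hg1 : (1 : ℝ) ≤ g := hu1.trans hgu.le
  refine ⟨g, by rw [hu] at hgu; exact_mod_cast hgu.le, ?_⟩
  intro J hJ L hL
  set Y : ℝ := (g : ℝ) ^ (6 * k + 5 + J) with hY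
  have hY1 : 1 ≤ Y := one_le_pow₀ hg1
  have hgY : (g : ℝ) ≤ Y := by
    calc (g : ℝ) = (g : ℝ) ^ 1 := (pow_one _).symm
      _ ≤ Y := pow_le_pow_right₀ hg1 (by omega)
  have hL1 : 1 ≤ L := by
    rw [hL]; exact one_le_mul_of_one_le_of_one_le hu1 (one_le_pow₀ hg1)
  have hWL1 : 1 ≤ W * L := one_le_mul_of_one_le_of_one_le hW hL1
  have ha0 : 0 ≤ a := by positivity
  have hx : ∀ x : ℝ, x ≤ Real.exp x := fun x => by
    have := Real.add_one_le_exp x; linarith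
  have hWL : W * L ≤ Real.exp (a * g) := by
    have h1 : W * u ≤ Real.exp (W * u * g) := by
      refine (hx _).trans ?_
      apply Real.exp_le_exp.2
      have : 0 ≤ W * u := by positivity
      nlinarith
    have h2 : (g : ℝ) ^ (4 * k + 2) ≤ Real.exp ((4 * k + 2) * g) := by
      have : Real.exp ((4 * k + 2) * g) = Real.exp g ^ (4 * k + 2) := by
        rw [← Real.exp_nat_mul]; push_cast; rfl
      rw [this]
      gcongr
      exact hx _
    calc W * L = (W * u) * (g : ℝ) ^ (4 * k + 2) := by rw [hL]; ring
      _ ≤ Real.exp (W * u * g) * Real.exp ((4 * k + 2) * g) := by gcongr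
      _ = Real.exp (a * g) := by rw [← Real.exp_add]; congr 1; rw [ha]; ring
  have e1 : L ^ (k + 1) ≤ Real.exp (a * (k + 1) * Y) := by
    calc L ^ (k + 1) ≤ (W * L) ^ (k + 1) := by
          gcongr; nlinarith
      _ ≤ Real.exp (a * g) ^ (k + 1) := by gcongr
      _ = Real.exp (a * (k + 1) * g) := by
          rw [← Real.exp_nat_mul]; congr 1; push_cast; ring
      _ ≤ _ := by apply Real.exp_le_exp.2; gcongr
  have e2 : C ≤ Real.exp (C * Y) := by
    refine (hx C).trans (Real.exp_le_exp.2 ?_)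
    nlinarith
  have hM : (g : ℝ) * (2 ^ T * (g : ℝ) ^ (4 * k + 4)) ≤ u * Y := by
    calc (g : ℝ) * (2 ^ T * (g : ℝ) ^ (4 * k + 4)) = 2 ^ T * (g : ℝ) ^ (4 * k + 5) := by ring
      _ ≤ u * Y := by
        gcongr
        · rw [hu]; exact pow_le_pow_right₀ (by norm_num) (by omega)
        · exact pow_le_pow_right₀ hg1 (by omega)
  have e3 : (W * L) ^ (2 ^ T * g ^ (4 * k + 4)) ≤ Real.exp (a * u * Y) := by
    calc (W * L) ^ (2 ^ T * g ^ (4 * k + 4)) ≤ Real.exp (a * g) ^ (2 ^ T * g ^ (4 * k + 4)) := by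
          gcongr
      _ = Real.exp (a * (g * (2 ^ T * (g : ℝ) ^ (4 * k + 4)))) := by
          rw [← Real.exp_nat_mul]; congr 1; push_cast; ring
      _ ≤ _ := by
          apply Real.exp_le_exp.2
          rw [mul_assoc]
          gcongr
  have e4 : (W * L) ^ ((k + 1) * (2 ^ T * g ^ (4 * k + 4))) ≤ Real.exp ((k + 1) * (a * u) * Y) := by
    rw [mul_comm (k + 1), pow_mul]
    calc _ ≤ Real.exp (a * u * Y) ^ (k + 1) := by gcongr
      _ = _ := by rw [← Real.exp_nat_mul]; congr 1; push_cast; ring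
  have e5 : Real.exp (W * L * (g : ℝ) ^ (2 * k + 2)) ≤ Real.exp (W * u * Y) := by
    apply Real.exp_le_exp.2
    have : W * L * (g : ℝ) ^ (2 * k + 2) = W * u * (g : ℝ) ^ (6 * k + 4) := by rw [hL]; ring
    rw [this]
    gcongr
    exact pow_le_pow_right₀ hg1 (by omega)
  have e6 : Real.exp (W * L * (3 * (g : ℝ) ^ (2 * k + 2 + (J + 1)))) ≤
      Real.exp (3 * (W * u) * Y) := by
    apply Real.exp_le_exp.2
    apply le_of_eq
    rw [hL, hY]; ring
  have hL0 : 0 ≤ L := by linarith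
  have hC0 : 0 ≤ C := by linarith
  have hW0 : 0 ≤ W := by linarith
  have hB : L ^ (k + 1) * (C * (C * L ^ (k + 1) * ((W * L) ^ ((k + 1) * (2 ^ T * g ^ (4 * k + 4))) *
        Real.exp (W * L * (g : ℝ) ^ (2 * k + 2)))) * (W * L) ^ (2 ^ T * g ^ (4 * k + 4)) *
        Real.exp (W * L * (3 * (g : ℝ) ^ (2 * k + 2 + (J + 1))))) ≤ Real.exp (c * Y) := by
    calc _ ≤ Real.exp (a * (k + 1) * Y) * (Real.exp (C * Y) * (Real.exp (C * Y) *
          Real.exp (a * (k + 1) * Y) * (Real.exp ((k + 1) * (a * u) * Y) *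
          Real.exp (W * u * Y))) * Real.exp (a * u * Y) * Real.exp (3 * (W * u) * Y)) := by
          gcongr
      _ = Real.exp (c * Y) := by
          simp only [← Real.exp_add]
          congr 1
          rw [hc]; ring
  have hhalf : (1 / 2 : ℝ) ≤ Real.exp (-(1 / 2)) := by
    have := Real.add_one_le_exp (-(1 / 2 : ℝ)); linarith
  have hsm : (1 / 2 : ℝ) ^ ((2 ^ (T - (J + 1)) * g ^ (4 * k + 4)) * g ^ (2 * k + 2 + J)) ≤
      Real.exp (-(1 / 2) * (g * Y)) := by
    calc _ ≤ (1 / 2 : ℝ) ^ (g ^ (6 * k + 6 + J)) := by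
          apply pow_le_pow_of_le_one (by norm_num) (by norm_num)
          calc g ^ (6 * k + 6 + J) = 1 * g ^ (4 * k + 4) * g ^ (2 * k + 2 + J) := by ring
            _ ≤ _ := by
              gcongr
              exact Nat.one_le_two_pow
      _ ≤ Real.exp (-(1 / 2)) ^ (g ^ (6 * k + 6 + J)) := by gcongr
      _ = _ := by
          rw [← Real.exp_nat_mul]; congr 1; push_cast; rw [hY]; ring
  calc _ ≤ Real.exp (c * Y) ^ (D + 1) * Real.exp (-(1 / 2) * (g * Y)) := by
        gcongr
    _ = Real.exp (((D + 1) * c - g / 2) * Y) := by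
        rw [← Real.exp_nat_mul, ← Real.exp_add]; congr 1; push_cast; ring
    _ < 1 := by
        rw [Real.exp_lt_one_iff]
        have : (D + 1) * c - g / 2 < 0 := by linarith
        nlinarith

section BakerMain

variable {ι K : Type} [Fintype ι] [Field K]

def bakerA (p : ι → ℕ) (P : ℕ) {L : ℕ} (x : (ι → Fin L) × Fin L) : ℕ :=
  (∏ i, p i ^ (x.1 i : ℕ)) * P ^ (x.2 : ℕ)

def bakerG (q : ℕ) (b : ι → 𝓞 K) {L : ℕ} (x : (ι → Fin L) × Fin L) (i : ι) : 𝓞 K :=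
  (q : 𝓞 K) * ((x.1 i : ℕ) : 𝓞 K) + ((x.2 : ℕ) : 𝓞 K) * b i

noncomputable def bakerE [DecidableEq ι] (p : ι → ℕ) (P q : ℕ) (b : ι → 𝓞 K) {L : ℕ}
    (c : (ι → Fin L) × Fin L → 𝓞 K) (m : ι → ℕ) (l : ℕ) : 𝓞 K :=
  ∑ x, c x * (∏ i, bakerG q b x i ^ m i) * (bakerA p P x : 𝓞 K) ^ l

noncomputable def bakerF [DecidableEq ι] (σ : K →+* ℂ) (p : ι → ℕ) (P q : ℕ) (b : ι → 𝓞 K) {L : ℕ}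
    (c : (ι → Fin L) × Fin L → 𝓞 K) (m : ι → ℕ) (z : ℂ) : ℂ :=
  ∑ x, σ (c x * ∏ i, bakerG q b x i ^ m i : 𝓞 K) *
    Complex.exp (z * (Real.log (bakerA p P x) : ℂ))

variable [DecidableEq ι] (σ : K →+* ℂ) (p : ι → ℕ) (P q : ℕ) (b : ι → 𝓞 K) {L : ℕ}
  (c : (ι → Fin L) × Fin L → 𝓞 K)

lemma bakerA_pos (hp : ∀ i, (p i).Prime) (hP : P.Prime) (x : (ι → Fin L) × Fin L) :
    0 < bakerA p P x := by
  unfold bakerA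
  have := hP.pos
  have : ∀ i, 0 < p i := fun i => (hp i).pos
  have : 0 < ∏ i, p i ^ (x.1 i : ℕ) := Finset.prod_pos fun i _ => pow_pos (this i) _
  positivity

lemma bakerA_inj (hp : ∀ i, (p i).Prime) (hP : P.Prime) (hinj : Function.Injective p)
    (hne : ∀ i, p i ≠ P) : Function.Injective (bakerA p P (L := L)) := by
  have hfac : ∀ x : (ι → Fin L) × Fin L, (bakerA p P x).factorization =
      (∑ i, Finsupp.single (p i) (x.1 i : ℕ)) + Finsupp.single P (x.2 : ℕ) := by
    intro x
    unfold bakerA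
    rw [Nat.factorization_mul, Nat.factorization_prod, hP.factorization_pow]
    · congr 1
      exact Finset.sum_congr rfl fun i _ => (hp i).factorization_pow
    · intro i _
      exact pow_ne_zero _ (hp i).ne_zero
    · rw [Finset.prod_ne_zero_iff]
      intro i _
      exact pow_ne_zero _ (hp i).ne_zero
    · exact pow_ne_zero _ hP.ne_zero
  intro x y hxy
  have h := congrArg Nat.factorization hxy
  rw [hfac, hfac] at h
  have hv1 : ∀ i, x.1 i = y.1 i := by
    intro i
    have := DFunLike.congr_fun h (p i)
    simp only [Finsupp.add_apply, Finsupp.finsetSum_apply, Finsupp.single_apply, hinj.eq_iff,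
      (hne i).symm] at this
    simp at this
    exact Fin.ext this
  have hv2 : x.2 = y.2 := by
    have := DFunLike.congr_fun h P
    simp only [Finsupp.add_apply, Finsupp.finsetSum_apply, Finsupp.single_apply, hne] at this
    simp at this
    exact Fin.ext this
  exact Prod.ext (funext hv1) hv2

lemma bakerF_nat (hp : ∀ i, (p i).Prime) (hP : P.Prime) (m : ι → ℕ) (l : ℕ) :
    bakerF σ p P q b c m (l : ℂ) = σ (bakerE p P q b c m l : 𝓞 K) := by
  unfold bakerF bakerE
  push_cast
  simp only [map_sum, map_mul, map_pow, map_natCast]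
  refine Finset.sum_congr rfl fun x _ => ?_
  congr 1
  rw [Complex.exp_nat_mul, Complex.exp_log (by
    exact_mod_cast (bakerA_pos p P hp hP x).ne')]

lemma bakerA_log (hp : ∀ i, (p i).Prime) (hP : P.Prime)
    (hrel : (q : ℂ) * (Real.log P : ℂ) = ∑ i, σ (b i : K) * (Real.log (p i) : ℂ))
    (x : (ι → Fin L) × Fin L) :
    (q : ℂ) * (Real.log (bakerA p P x) : ℂ) =
      ∑ i, (Real.log (p i) : ℂ) * σ (bakerG q b x i : 𝓞 K) := by
  have h1 : Real.log (bakerA p P x) =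
      (∑ i, ((x.1 i : ℕ) : ℝ) * Real.log (p i)) + ((x.2 : ℕ) : ℝ) * Real.log P := by
    unfold bakerA
    push_cast
    rw [Real.log_mul, Real.log_prod, Real.log_pow]
    · congr 1
      exact Finset.sum_congr rfl fun i _ => Real.log_pow _ _
    · intro i _
      have := (hp i).ne_zero
      positivity
    · rw [Finset.prod_ne_zero_iff]
      intro i _
      have := (hp i).ne_zero
      positivity
    · have := hP.ne_zero
      positivity
  rw [h1]
  simp only [Complex.ofReal_add, Complex.ofReal_sum, Complex.ofReal_mul, Complex.ofReal_natCast]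
  rw [mul_add, mul_left_comm, hrel, Finset.mul_sum, Finset.mul_sum, ← Finset.sum_add_distrib]
  refine Finset.sum_congr rfl fun i _ => ?_
  unfold bakerG
  push_cast
  simp only [map_add, map_mul, map_natCast]
  ring

lemma bakerF_hasDerivAt (hp : ∀ i, (p i).Prime) (hP : P.Prime) (hq : 0 < q)
    (hrel : (q : ℂ) * (Real.log P : ℂ) = ∑ i, σ (b i : K) * (Real.log (p i) : ℂ))
    (m : ι → ℕ) (z : ℂ) :
    HasDerivAt (bakerF σ p P q b c m)
      (∑ i, ((Real.log (p i) : ℂ) / q) * bakerF σ p P q b c (m + Pi.single i 1) z) z := by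
  have h1 : HasDerivAt (bakerF σ p P q b c m)
      (∑ x, σ (c x * ∏ i, bakerG q b x i ^ m i : 𝓞 K) *
        (Complex.exp (z * (Real.log (bakerA p P x) : ℂ)) *
          (1 * (Real.log (bakerA p P x) : ℂ)))) z := by
    unfold bakerF
    apply HasDerivAt.fun_sum
    intro x _
    exact (((hasDerivAt_id z).mul_const _).cexp).const_mul _
  convert h1 using 1
  unfold bakerF
  simp only [Finset.mul_sum]
  rw [Finset.sum_comm]
  refine Finset.sum_congr rfl fun x _ => ?_
  have hq' : (q : ℂ) ≠ 0 := by exact_mod_cast hq.ne'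
  have hA : (Real.log (bakerA p P x) : ℂ) =
      ∑ i, (Real.log (p i) : ℂ) / q * σ (bakerG q b x i : 𝓞 K) := by
    have := bakerA_log σ p P q b hp hP hrel x
    rw [← mul_right_inj' hq', this, Finset.mul_sum]
    refine Finset.sum_congr rfl fun i _ => ?_
    field_simp
  have hprod : ∀ i, (∏ j, bakerG q b x j ^ (m + Pi.single i 1 : ι → ℕ) j) =
      (∏ j, bakerG q b x j ^ m j) * bakerG q b x i := by
    intro i
    simp only [Pi.add_apply, pow_add, Finset.prod_mul_distrib]
    congr 1
    rw [Finset.prod_eq_single i]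
    · simp
    · intro j _ hj
      simp [Pi.single_apply, hj]
    · simp
  simp only [hprod]
  conv_rhs => rw [one_mul]; enter [2, 2]; rw [hA]
  rw [Finset.mul_sum, Finset.mul_sum]
  refine Finset.sum_congr rfl fun i _ => ?_
  push_cast
  simp only [map_mul]
  ring

lemma bakerF_differentiable (m : ι → ℕ) : Differentiable ℂ (bakerF σ p P q b c m) := by
  unfold bakerF
  fun_prop

lemma bakerF_iteratedDeriv (hp : ∀ i, (p i).Prime) (hP : P.Prime) (hq : 0 < q)
    (hrel : (q : ℂ) * (Real.log P : ℂ) = ∑ i, σ (b i : K) * (Real.log (p i) : ℂ))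
    (j : ℕ) (m : ι → ℕ) (l : ℕ)
    (h : ∀ m' : ι → ℕ, ∑ i, m' i ≤ ∑ i, m i + j → bakerE p P q b c m' l = 0) :
    iteratedDeriv j (bakerF σ p P q b c m) (l : ℂ) = 0 := by
  induction j generalizing m with
  | zero =>
    rw [iteratedDeriv_zero, bakerF_nat σ p P q b c hp hP, h m (by simp)]
    simp
  | succ j ih =>
    rw [iteratedDeriv_succ']
    have hd : deriv (bakerF σ p P q b c m) = fun z =>
        ∑ i, ((Real.log (p i) : ℂ) / q) * bakerF σ p P q b c (m + Pi.single i 1) z := by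
      funext z
      exact (bakerF_hasDerivAt σ p P q b c hp hP hq hrel m z).deriv
    have hcd : ∀ m' : ι → ℕ, ContDiff ℂ j (bakerF σ p P q b c m') := fun m' =>
      (bakerF_differentiable σ p P q b c m').contDiff
    rw [hd, iteratedDeriv_fun_sum (by
      intro i _
      exact (contDiff_const.mul (hcd _)).contDiffAt)]
    refine Finset.sum_eq_zero fun i _ => ?_
    rw [iteratedDeriv_const_mul_field, ih, mul_zero]
    intro m' hm'
    apply h
    refine hm'.trans ?_
    simp only [Pi.add_apply, Finset.sum_add_distrib, Finset.sum_pi_single', Finset.mem_univ,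
      if_true]
    omega

variable [NumberField K]

lemma baker_house_nat (n : ℕ) : house ((n : 𝓞 K) : K) = n := by
  have := house_intCast (K := K) (n : ℤ)
  simpa using this

lemma baker_house_mul_le (x y : 𝓞 K) : house ((x * y : 𝓞 K) : K) ≤ house (x : K) * house (y : K) := by
  have := house_mul_le (x : K) (y : K)
  simpa using this

lemma baker_house_pow_le (x : 𝓞 K) (n : ℕ) : house ((x ^ n : 𝓞 K) : K) ≤ house (x : K) ^ n := by
  have := house_pow_le (x : K) n
  simpa using this

lemma baker_house_sum_le {α : Type} (s : Finset α) (f : α → 𝓞 K) :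
    house ((∑ i ∈ s, f i : 𝓞 K) : K) ≤ ∑ i ∈ s, house (f i : K) := by
  have h1 : ((∑ i ∈ s, f i : 𝓞 K) : K) = ∑ i ∈ s, (f i : K) := map_sum (algebraMap (𝓞 K) K) _ _
  rw [h1]
  exact house_sum_le_sum_house _ _

lemma baker_house_prod_le {α : Type} (s : Finset α) (f : α → 𝓞 K) :
    house ((∏ i ∈ s, f i : 𝓞 K) : K) ≤ ∏ i ∈ s, house (f i : K) := by
  classical
  induction s using Finset.induction_on with
  | empty =>
    have := baker_house_nat (K := K) 1
    simp at this ⊢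
    exact this.le
  | insert a s ha ih =>
    rw [Finset.prod_insert ha, Finset.prod_insert ha]
    refine (baker_house_mul_le _ _).trans ?_
    gcongr
    exact house_nonneg _

lemma baker_house_monomial (V : ℝ) (hG : ∀ (x : (ι → Fin L) × Fin L) i,
    house (bakerG q b x i : K) ≤ V) (m : ι → ℕ) (x : (ι → Fin L) × Fin L) :
    house ((∏ i, bakerG q b x i ^ m i : 𝓞 K) : K) ≤ V ^ (∑ i, m i) := by
  refine (baker_house_prod_le _ _).trans ?_
  rw [← Finset.prod_pow_eq_pow_sum]
  apply Finset.prod_le_prod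
  · intros; exact house_nonneg _
  · intro i _
    refine (baker_house_pow_le _ _).trans ?_
    gcongr
    · exact house_nonneg _
    · exact hG x i

lemma baker_house_entry (V Q : ℝ) (hV : 0 ≤ V) (hG : ∀ (x : (ι → Fin L) × Fin L) i,
    house (bakerG q b x i : K) ≤ V)
    (hA : ∀ x : (ι → Fin L) × Fin L, (bakerA p P x : ℝ) ≤ Real.exp Q)
    (m : ι → ℕ) (l : ℕ) (x : (ι → Fin L) × Fin L) :
    house (((∏ i, bakerG q b x i ^ m i) * (bakerA p P x : 𝓞 K) ^ l : 𝓞 K) : K) ≤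
      V ^ (∑ i, m i) * Real.exp (Q * l) := by
  have h1 := baker_house_monomial q b V hG m x
  refine (baker_house_mul_le _ _).trans ?_
  gcongr
  · exact house_nonneg _
  · refine (baker_house_pow_le _ _).trans ?_
    rw [mul_comm, Real.exp_nat_mul]
    gcongr
    · exact house_nonneg _
    · rw [baker_house_nat]; exact hA x

lemma bakerE_house (V Q C0 : ℝ) (hV : 0 ≤ V) (hC0 : 0 ≤ C0)
    (hG : ∀ (x : (ι → Fin L) × Fin L) i, house (bakerG q b x i : K) ≤ V)
    (hA : ∀ x : (ι → Fin L) × Fin L, (bakerA p P x : ℝ) ≤ Real.exp Q)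
    (hc : ∀ x, house (c x : K) ≤ C0) (m : ι → ℕ) (l : ℕ) :
    house (bakerE p P q b c m l : K) ≤
      (L : ℝ) ^ (Fintype.card ι + 1) * (C0 * V ^ (∑ i, m i) * Real.exp (Q * l)) := by
  unfold bakerE
  refine (baker_house_sum_le _ _).trans ?_
  refine (Finset.sum_le_card_nsmul _ _ (C0 * V ^ (∑ i, m i) * Real.exp (Q * l)) ?_).trans ?_
  · intro x _
    rw [mul_assoc, mul_assoc]
    refine (baker_house_mul_le _ _).trans ?_
    gcongr
    · exact house_nonneg _
    · exact hc x
    · exact baker_house_entry p P q b V Q hV hG hA m l x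
  · simp [Finset.card_univ, pow_succ]

lemma bakerF_norm (V Q C0 : ℝ) (hp : ∀ i, (p i).Prime) (hP : P.Prime) (hV : 0 ≤ V) (hC0 : 0 ≤ C0)
    (hQ : 0 ≤ Q)
    (hG : ∀ (x : (ι → Fin L) × Fin L) i, house (bakerG q b x i : K) ≤ V)
    (hA : ∀ x : (ι → Fin L) × Fin L, (bakerA p P x : ℝ) ≤ Real.exp Q)
    (hc : ∀ x, house (c x : K) ≤ C0) (m : ι → ℕ) (z : ℂ) (ρ : ℝ) (hz : ‖z‖ ≤ ρ) :
    ‖bakerF σ p P q b c m z‖ ≤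
      (L : ℝ) ^ (Fintype.card ι + 1) * (C0 * V ^ (∑ i, m i) * Real.exp (Q * ρ)) := by
  unfold bakerF
  refine (norm_sum_le _ _).trans ?_
  refine (Finset.sum_le_card_nsmul _ _ (C0 * V ^ (∑ i, m i) * Real.exp (Q * ρ)) ?_).trans ?_
  · intro x _
    rw [norm_mul]
    gcongr
    · refine (norm_embedding_le_house _ _).trans ?_
      refine (baker_house_mul_le _ _).trans ?_
      gcongr
      · exact house_nonneg _
      · exact hc x
      · exact baker_house_monomial q b V hG m x
    · rw [Complex.norm_exp]
      apply Real.exp_le_exp.2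
      have hA1 : (1 : ℝ) ≤ bakerA p P x := by exact_mod_cast bakerA_pos p P hp hP x
      have hlog0 : 0 ≤ Real.log (bakerA p P x) := Real.log_nonneg hA1
      have hlogQ : Real.log (bakerA p P x) ≤ Q := by
        rw [Real.log_le_iff_le_exp (by linarith)]; exact hA x
      rw [Complex.re_mul_ofReal]
      calc z.re * Real.log (bakerA p P x) ≤ ‖z‖ * Real.log (bakerA p P x) := by
            gcongr; exact Complex.re_le_norm z
        _ ≤ ρ * Q := by
            gcongr
            exact (norm_nonneg _).trans hz
        _ = Q * ρ := mul_comm _ _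
  · simp [Finset.card_univ, pow_succ]

lemma baker_step (V Q C0 : ℝ) (hp : ∀ i, (p i).Prime) (hP : P.Prime) (hq : 0 < q)
    (hrel : (q : ℂ) * (Real.log P : ℂ) = ∑ i, σ (b i : K) * (Real.log (p i) : ℂ))
    (hV : 1 ≤ V) (hC0 : 1 ≤ C0) (hQ : 0 ≤ Q) (hL : 0 < L)
    (hG : ∀ (x : (ι → Fin L) × Fin L) i, house (bakerG q b x i : K) ≤ V)
    (hA : ∀ x : (ι → Fin L) × Fin L, (bakerA p P x : ℝ) ≤ Real.exp Q)
    (hc : ∀ x, house (c x : K) ≤ C0) (M S R R' : ℕ) (hSM : S ≤ M) (hRR : R ≤ R')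
    (hsmall : ((L : ℝ) ^ (Fintype.card ι + 1) * (C0 * V ^ M * Real.exp (Q * (3 * (R' : ℝ))))) ^
      (finrank ℚ K + 1) * (1 / 2 : ℝ) ^ (S * R) < 1)
    (hyp : ∀ m : ι → ℕ, ∑ i, m i < 2 * S → ∀ l < R, bakerE p P q b c m l = 0) :
    ∀ m : ι → ℕ, ∑ i, m i < S → ∀ l < R', bakerE p P q b c m l = 0 := by
  intro m hm x hx
  by_contra hne
  set B := (L : ℝ) ^ (Fintype.card ι + 1) * (C0 * V ^ M * Real.exp (Q * (3 * (R' : ℝ)))) with hB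
  have hL1 : (1 : ℝ) ≤ L := by exact_mod_cast hL
  have hVM : V ^ (∑ i, m i) ≤ V ^ M := pow_le_pow_right₀ hV (by omega)
  have hB1 : 1 ≤ B := by
    apply one_le_mul_of_one_le_of_one_le (one_le_pow₀ hL1)
    apply one_le_mul_of_one_le_of_one_le
    · exact one_le_mul_of_one_le_of_one_le hC0 (one_le_pow₀ hV)
    · exact Real.one_le_exp (by positivity)
  have hhouse : house (bakerE p P q b c m x : K) ≤ B := by
    refine (bakerE_house p P q b c V Q C0 (by linarith) (by linarith) hG hA hc m x).trans ?_
    have : (x : ℝ) ≤ 3 * (R' : ℝ) := by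
      have h1 : (x : ℝ) ≤ R' := by exact_mod_cast hx.le
      have h2 : (0 : ℝ) ≤ R' := by positivity
      linarith
    rw [hB]
    gcongr
  have hschw : ‖bakerF σ p P q b c m (x : ℂ)‖ ≤ B * (1 / 2) ^ (S * R) := by
    apply baker_schwarz _ (bakerF_differentiable σ p P q b c m) R R' S hRR B _ _ x hx
    · intro l hl j hj
      apply bakerF_iteratedDeriv σ p P q b c hp hP hq hrel
      intro m' hm'
      exact hyp m' (by omega) l hl
    · intro z hz
      refine (bakerF_norm σ p P q b c V Q C0 hp hP (by linarith) (by linarith) hQ hG hA hc m z _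
        hz).trans ?_
      rw [hB]
      gcongr
  rw [bakerF_nat σ p P q b c hp hP] at hschw
  have hli := baker_liouville K σ _ hne B hhouse hB1
  have : (1 : ℝ) ≤ B ^ (finrank ℚ K + 1) * (1 / 2 : ℝ) ^ (S * R) := by
    refine hli.trans ?_
    calc _ ≤ (B * (1 / 2) ^ (S * R)) * B ^ finrank ℚ K := by gcongr
      _ = _ := by ring
  linarith

end BakerMain

lemma baker_main {ι K : Type} [Fintype ι] [DecidableEq ι] [Field K] [NumberField K]
    (σ : K →+* ℂ) (p : ι → ℕ) (P q : ℕ) (b : ι → 𝓞 K)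
    (hp : ∀ i, (p i).Prime) (hP : P.Prime) (hinj : Function.Injective p) (hne : ∀ i, p i ≠ P)
    (hq : 0 < q)
    (hrel : (q : ℂ) * (Real.log P : ℂ) = ∑ i, σ (b i : K) * (Real.log (p i) : ℂ)) : False := by
  set k := Fintype.card ι with hk
  obtain ⟨C, hC1, hC⟩ := baker_siegel K
  set H : ℝ := ∑ i, house (b i : K) with hH
  have hH0 : 0 ≤ H := Finset.sum_nonneg fun i _ => house_nonneg _
  have hHi : ∀ i, house (b i : K) ≤ H := fun i =>
    Finset.single_le_sum (f := fun i => house (b i : K)) (fun i _ => house_nonneg _)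
      (Finset.mem_univ i)
  set W : ℝ := 1 + q + H + ((∏ i, p i) * P : ℕ) with hW
  have hq0 : (0 : ℝ) ≤ q := by positivity
  have hPP : (0 : ℝ) ≤ ((∏ i, p i) * P : ℕ) := by positivity
  have hW1 : 1 ≤ W := by linarith
  set T := 4 * (k + 1) ^ 2 with hT
  obtain ⟨g, hgT, hasym⟩ := baker_asymp k (finrank ℚ K) W C hW1 hC1 T
  have hg0 : 0 < g := lt_of_lt_of_le (by positivity) hgT
  set L : ℕ := 2 ^ (T + 1) * g ^ (4 * k + 2) with hL
  have hL0 : 0 < L := by positivity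
  have hLr : (L : ℝ) = 2 ^ (T + 1) * (g : ℝ) ^ (4 * k + 2) := by rw [hL]; push_cast; rfl
  have hL1 : (1 : ℝ) ≤ L := by exact_mod_cast hL0
  have hWL1 : 1 ≤ W * L := one_le_mul_of_one_le_of_one_le hW1 hL1
  set M0 : ℕ := 2 ^ T * g ^ (4 * k + 4) with hM0
  have hM00 : 0 < M0 := by positivity
  set R0 : ℕ := g ^ (2 * k + 2) with hR0
  have hR00 : 0 < R0 := by positivity
  have hG : ∀ (x : (ι → Fin L) × Fin L) i, house (bakerG q b x i : K) ≤ W * L := by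
    intro x i
    have h1 : (bakerG q b x i : K) = (q : K) * (((x.1 i : ℕ) : ℕ) : K) + ((x.2 : ℕ) : K) * b i := by
      unfold bakerG; simp
    rw [h1]
    refine (house_add_le _ _).trans ?_
    rw [house_nat_mul, house_nat_mul]
    have h2 : house (((x.1 i : ℕ) : ℕ) : K) = (x.1 i : ℕ) := by
      have := house_intCast (K := K) (x.1 i : ℕ)
      simpa using this
    rw [h2]
    have h3 : ((x.1 i : ℕ) : ℝ) ≤ L := by exact_mod_cast (x.1 i).2.le
    have h4 : ((x.2 : ℕ) : ℝ) ≤ L := by exact_mod_cast x.2.2.le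
    calc (q : ℝ) * ((x.1 i : ℕ) : ℝ) + ((x.2 : ℕ) : ℝ) * house (b i : K) ≤ q * L + L * H := by
          gcongr
          · exact house_nonneg _
          · exact hHi i
      _ = (q + H) * L := by ring
      _ ≤ W * L := by gcongr; linarith
  have hA : ∀ x : (ι → Fin L) × Fin L, (bakerA p P x : ℝ) ≤ Real.exp (W * L) := by
    intro x
    have h1 : bakerA p P x ≤ ((∏ i, p i) * P) ^ L := by
      unfold bakerA
      rw [mul_pow, ← Finset.prod_pow]
      gcongr with i
      · exact (hp i).pos
      · exact (x.1 i).2.le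
      · exact hP.pos
      · exact x.2.2.le
    calc (bakerA p P x : ℝ) ≤ (((∏ i, p i) * P : ℕ) : ℝ) ^ L := by exact_mod_cast h1
      _ ≤ Real.exp W ^ L := by
        gcongr
        have := Real.add_one_le_exp W
        linarith
      _ = Real.exp (W * L) := by rw [← Real.exp_nat_mul, mul_comm]
  set A0 : ℝ := (W * L) ^ ((k + 1) * M0) * Real.exp (W * L * (g : ℝ) ^ (2 * k + 2)) with hA0
  have hA01 : 1 ≤ A0 := by
    apply one_le_mul_of_one_le_of_one_le (one_le_pow₀ hWL1)
    exact Real.one_le_exp (by positivity)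
  have hcardβ : Fintype.card ((ι → Fin L) × Fin L) = L ^ (k + 1) := by
    simp [pow_succ, hk]
  have hcardα : Fintype.card ((ι → Fin M0) × Fin R0) = M0 ^ k * R0 := by
    simp [hk]
  obtain ⟨c, hc0, hcE, hcH⟩ := hC ((ι → Fin M0) × Fin R0) ((ι → Fin L) × Fin L)
    (Matrix.of fun y x => (∏ i, bakerG q b x i ^ (y.1 i : ℕ)) * (bakerA p P x : 𝓞 K) ^ (y.2 : ℕ))
    A0 (by
      intro h0
      have := congrFun (congrFun h0 (fun _ => ⟨0, hM00⟩, ⟨0, hR00⟩)) (fun _ => ⟨0, hL0⟩, ⟨0, hL0⟩)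
      simp at this) hA01 (by
      intro y x
      rw [Matrix.of_apply]
      refine (baker_house_entry p P q b (W * L) (W * L) (by linarith) hG hA
        (fun i => (y.1 i : ℕ)) (y.2 : ℕ) x).trans ?_
      rw [hA0]
      gcongr
      · calc ∑ i, (y.1 i : ℕ) ≤ ∑ i : ι, M0 := Finset.sum_le_sum fun i _ => (y.1 i).2.le
          _ = k * M0 := by simp [hk]
          _ ≤ (k + 1) * M0 := by gcongr; omega
      · have : ((y.2 : ℕ) : ℝ) ≤ (R0 : ℕ) := by exact_mod_cast y.2.2.le
        refine this.trans (le_of_eq ?_)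
        rw [hR0]
        push_cast
        rfl) (by
      rw [hcardα]; positivity) (by
      rw [hcardα, hcardβ, hM0, hR0, hL]
      calc 2 * ((2 ^ T * g ^ (4 * k + 4)) ^ k * g ^ (2 * k + 2))
          = 2 ^ (1 + T * k) * g ^ ((4 * k + 2) * (k + 1)) := by
            rw [mul_pow, ← pow_mul, ← pow_mul, pow_add 2 1, pow_one]
            have : (4 * k + 2) * (k + 1) = (4 * k + 4) * k + (2 * k + 2) := by ring
            rw [this, pow_add]
            ring
        _ ≤ 2 ^ ((T + 1) * (k + 1)) * g ^ ((4 * k + 2) * (k + 1)) := by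
            gcongr
            · norm_num
            · nlinarith
        _ = _ := by rw [mul_pow, ← pow_mul, ← pow_mul])
  set C0 : ℝ := C * (C * (L : ℝ) ^ (k + 1) * A0) with hC0
  have hcH' : ∀ x, house (c x : K) ≤ C0 := by
    intro x
    have := hcH x
    rw [hcardβ] at this
    push_cast at this
    exact this
  have hC01 : 1 ≤ C0 := by
    apply one_le_mul_of_one_le_of_one_le hC1
    apply one_le_mul_of_one_le_of_one_le _ hA01
    exact one_le_mul_of_one_le_of_one_le hC1 (one_le_pow₀ hL1)
  have hind : ∀ J ≤ T, ∀ m : ι → ℕ, ∑ i, m i < 2 ^ (T - J) * g ^ (4 * k + 4) →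
      ∀ l < g ^ (2 * k + 2 + J), bakerE p P q b c m l = 0 := by
    intro J
    induction J with
    | zero =>
      intro _ m hm l hl
      have hmi : ∀ i, m i < M0 := fun i =>
        lt_of_le_of_lt (Finset.single_le_sum (f := m) (fun i _ => Nat.zero_le _)
          (Finset.mem_univ i)) hm
      have := congrFun hcE (fun i => ⟨m i, hmi i⟩, ⟨l, hl⟩)
      simp only [Matrix.mulVec, dotProduct, Matrix.of_apply, Pi.zero_apply] at this
      unfold bakerE
      rw [← this]
      refine Finset.sum_congr rfl fun x _ => ?_
      ring
    | succ J ih =>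
      intro hJ
      have ih' := ih (by omega)
      apply baker_step σ p P q b c (W * L) (W * L) C0 hp hP hq hrel hWL1 hC01 (by linarith) hL0
        hG hA hcH' M0 _ (g ^ (2 * k + 2 + J)) (g ^ (2 * k + 2 + (J + 1)))
      · rw [hM0]
        gcongr
        · norm_num
        · omega
      · exact Nat.pow_le_pow_right hg0 (by omega)
      · have := hasym J (by omega) L hLr
        rw [← hk, hC0, hA0, hM0]
        push_cast
        push_cast at this
        exact this
      · intro m hm l hl
        apply ih' m _ l hl
        refine lt_of_lt_of_eq hm ?_
        rw [← mul_assoc, ← pow_succ']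
        congr 2
        omega
  apply hc0
  apply baker_vandermonde (fun x => (bakerA p P x : 𝓞 K))
  · intro x y hxy
    exact bakerA_inj p P hp hP hinj hne (Nat.cast_injective (R := 𝓞 K) hxy)
  · intro l hl
    have := hind T le_rfl 0 (by simp; positivity) l (by
      refine lt_of_lt_of_le hl ?_
      rw [hcardβ, hL, mul_pow, ← pow_mul g]
      calc (2 ^ (T + 1)) ^ (k + 1) * g ^ ((4 * k + 2) * (k + 1))
          ≤ g ^ (k + 1) * g ^ ((4 * k + 2) * (k + 1)) := by gcongr
        _ = g ^ (k + 1 + (4 * k + 2) * (k + 1)) := by rw [← pow_add]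
        _ ≤ g ^ (2 * k + 2 + T) := by
          apply Nat.pow_le_pow_right hg0
          rw [hT]; nlinarith)
    simpa [bakerE] using this

lemma baker_log_primes :
    LinearIndependent (algebraicClosure ℚ ℝ)
      (fun x : {p : ℕ // p.Prime} => Real.log (x : ℕ)) := by
  classical
  rw [linearIndependent_iff']
  intro s w hsum P hPs
  by_contra hw
  set ι := {x // x ∈ s.erase P} with hι
  let βr : ι → ℝ := fun i => -((w i.1 : ℝ) / (w P : ℝ))
  have hwP : (w P : ℝ) ≠ 0 := by simpa using hw
  have hβ : ∀ i, IsAlgebraic ℚ (βr i) := by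
    intro i
    have h1 : (w i.1 : ℝ) ∈ algebraicClosure ℚ ℝ := (w i.1).2
    have h2 : (w P : ℝ) ∈ algebraicClosure ℚ ℝ := (w P).2
    have : βr i ∈ algebraicClosure ℚ ℝ := neg_mem (div_mem h1 h2)
    exact mem_algebraicClosure_iff.1 this
  have hrel : Real.log (P : ℕ) = ∑ i : ι, βr i * Real.log ((i.1 : {p : ℕ // p.Prime}) : ℕ) := by
    have h1 : ∑ x ∈ s, (w x : ℝ) * Real.log (x : ℕ) = 0 := hsum
    rw [← Finset.add_sum_erase s _ hPs] at h1
    have h2 : ∑ i : ι, βr i * Real.log ((i.1 : {p : ℕ // p.Prime}) : ℕ) =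
        ∑ x ∈ s.erase P, -((w x : ℝ) / (w P : ℝ)) * Real.log (x : ℕ) :=
      Finset.sum_coe_sort (s.erase P) (fun x => -((w x : ℝ) / (w P : ℝ)) * Real.log (x : ℕ))
    rw [h2]
    have h3 : ∑ x ∈ s.erase P, -((w x : ℝ) / (w P : ℝ)) * Real.log (x : ℕ) =
        -(∑ x ∈ s.erase P, (w x : ℝ) * Real.log (x : ℕ)) / w P := by
      rw [← Finset.sum_neg_distrib, Finset.sum_div]
      refine Finset.sum_congr rfl fun x _ => ?_
      ring
    rw [h3, eq_div_iff hwP]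
    linarith
  let K := IntermediateField.adjoin ℚ (Set.range βr)
  have : FiniteDimensional ℚ K := IntermediateField.finiteDimensional_adjoin (by
    rintro _ ⟨i, rfl⟩
    exact (hβ i).isIntegral)
  have : NumberField K := { to_charZero := inferInstance, to_finiteDimensional := inferInstance }
  let β : ι → K := fun i => ⟨βr i, IntermediateField.subset_adjoin _ _ ⟨i, rfl⟩⟩
  let σ : K →+* ℂ := (algebraMap ℝ ℂ).comp (algebraMap K ℝ)
  have hmul : ∃ q : ℕ, 0 < q ∧ ∀ i, IsIntegral ℤ ((q : K) * β i) := by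
    have h1 : ∀ i, ∃ q : ℕ, 0 < q ∧ IsIntegral ℤ ((q : K) * β i) := by
      intro i
      have halg : IsAlgebraic ℤ (β i) :=
        (IsFractionRing.isAlgebraic_iff ℤ ℚ K).2 (Algebra.IsAlgebraic.isAlgebraic (β i))
      obtain ⟨y, hy, hyi⟩ := halg.exists_integral_multiple
      refine ⟨y.natAbs, Int.natAbs_pos.2 hy, ?_⟩
      rw [zsmul_eq_mul] at hyi
      rcases Int.natAbs_eq y with h | h
      · rw [h] at hyi
        simpa using hyi
      · rw [h] at hyi
        simpa using hyi.neg
    choose q hq hqi using h1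
    refine ⟨∏ i, q i, Finset.prod_pos fun i _ => hq i, fun i => ?_⟩
    rw [← Finset.prod_erase_mul _ _ (Finset.mem_univ i)]
    push_cast
    rw [mul_assoc]
    refine IsIntegral.mul ?_ (hqi i)
    have := isIntegral_algebraMap (R := ℤ) (A := K)
      (x := ((∏ x ∈ Finset.univ.erase i, q x : ℕ) : ℤ))
    simpa using this
  obtain ⟨q, hq, hqi⟩ := hmul
  refine baker_main σ (fun i : ι => ((i.1 : {p : ℕ // p.Prime}) : ℕ)) P q
    (fun i => (⟨(q : K) * β i, hqi i⟩ : 𝓞 K)) (fun i => i.1.2) P.2 ?_ ?_ hq ?_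
  · intro i j hij
    exact Subtype.ext (Subtype.ext hij)
  · intro i hi
    exact (Finset.mem_erase.1 i.2).1 (Subtype.ext hi)
  · rw [hrel, Complex.ofReal_sum, Finset.mul_sum]
    refine Finset.sum_congr rfl fun i _ => ?_
    have : σ ((q : K) * β i) = (q : ℂ) * (βr i : ℂ) := by
      rw [map_mul, map_natCast]
      rfl
    rw [Complex.ofReal_mul, ← mul_assoc, ← this]
    rfl

/-- If `d₁ = 1, d₂, …, d_r` are real algebraic numbers linearly independent over `ℚ`,
then the numbers `dⱼ · log p` (`p` prime, `1 ≤ j ≤ r`) are linearly independent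
over `ℚ`. -/
theorem mul_log_primes_linearIndependent (r : ℕ) (hr : 0 < r) (d : Fin r → ℝ)
    (h1 : d ⟨0, hr⟩ = 1) (halg : ∀ j, IsAlgebraic ℚ (d j))
    (hind : LinearIndependent ℚ d) :
    LinearIndependent ℚ
      (fun x : Fin r × {p : ℕ // p.Prime} => d x.1 * Real.log (x.2 : ℕ)) := by
  let d' : Fin r → algebraicClosure ℚ ℝ := fun j => ⟨d j, mem_algebraicClosure_iff.2 (halg j)⟩
  have hd' : LinearIndependent ℚ d' := by
    apply LinearIndependent.of_comp (algebraicClosure ℚ ℝ).val.toLinearMap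
    exact hind
  have key := linearIndependent_smul (R := ℚ) (S := algebraicClosure ℚ ℝ) (A := ℝ) hd'
    baker_log_primes
  have hfun : (fun x : Fin r × {p : ℕ // p.Prime} => d x.1 * Real.log (x.2 : ℕ)) =
      fun x : Fin r × {p : ℕ // p.Prime} => d' x.1 • Real.log (x.2 : ℕ) := by
    funext x
    rfl
  rw [hfun]
  exact key
end

section
/- Mergelyan's theorem: Let K be a compact subset of ℂ with connected complement, and let f be continuous on K and holomorphic in the interior of K. Then for every ε > 0 there exists a polynomial P with complex coefficients such that sup_{s∈K} |f(s) − P(s)| < ε. -/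
/-- `f` is a uniform limit on `K` of polynomials. -/
def PolyApprox (K : Set ℂ) (f : ℂ → ℂ) : Prop :=
  ∀ ε : ℝ, 0 < ε → ∃ P : Polynomial ℂ, ∀ s ∈ K, ‖f s - P.eval s‖ < ε

namespace PolyApprox

variable {K : Set ℂ} {f g : ℂ → ℂ}

theorem poly (P : Polynomial ℂ) : PolyApprox K (fun z => P.eval z) := by
  intro ε hε
  exact ⟨P, fun s _ => by simpa using hε⟩

theorem const (c : ℂ) : PolyApprox K (fun _ => c) := by
  simpa using poly (K := K) (Polynomial.C c)

theorem id : PolyApprox K (fun z => z) := by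
  simpa using poly (K := K) Polynomial.X

theorem congr (hf : PolyApprox K f) (h : ∀ z ∈ K, f z = g z) : PolyApprox K g := by
  intro ε hε
  obtain ⟨P, hP⟩ := hf ε hε
  exact ⟨P, fun s hs => by rw [← h s hs]; exact hP s hs⟩

theorem of_approx (h : ∀ ε : ℝ, 0 < ε → ∃ g, PolyApprox K g ∧ ∀ z ∈ K, ‖f z - g z‖ < ε) :
    PolyApprox K f := by
  intro ε hε
  obtain ⟨g, hg, hfg⟩ := h (ε / 2) (by positivity)
  obtain ⟨P, hP⟩ := hg (ε / 2) (by positivity)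
  refine ⟨P, fun s hs => ?_⟩
  have h1 := hfg s hs
  have h2 := hP s hs
  calc ‖f s - P.eval s‖ = ‖(f s - g s) + (g s - P.eval s)‖ := by congr 1; ring
    _ ≤ _ := norm_add_le _ _
    _ < ε := by linarith

theorem add (hf : PolyApprox K f) (hg : PolyApprox K g) : PolyApprox K (fun z => f z + g z) := by
  intro ε hε
  obtain ⟨P, hP⟩ := hf (ε / 2) (by positivity)
  obtain ⟨Q, hQ⟩ := hg (ε / 2) (by positivity)
  refine ⟨P + Q, fun s hs => ?_⟩
  have h1 := hP s hs
  have h2 := hQ s hs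
  calc ‖f s + g s - (P + Q).eval s‖ = ‖(f s - P.eval s) + (g s - Q.eval s)‖ := by
        congr 1; simp; ring
    _ ≤ _ := norm_add_le _ _
    _ < ε := by linarith

theorem bdd (hK : IsCompact K) (hf : PolyApprox K f) : ∃ C : ℝ, 0 < C ∧ ∀ z ∈ K, ‖f z‖ ≤ C := by
  obtain ⟨P, hP⟩ := hf 1 one_pos
  obtain ⟨C, hC⟩ := hK.exists_bound_of_continuousOn (f := fun z => P.eval z) (by fun_prop)
  refine ⟨|C| + 1, by positivity, fun z hz => ?_⟩
  have h1 := hP z hz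
  have h2 := hC z hz
  calc ‖f z‖ = ‖(f z - P.eval z) + P.eval z‖ := by congr 1; ring
    _ ≤ _ := norm_add_le _ _
    _ ≤ _ := by linarith [le_abs_self C]

theorem mul (hK : IsCompact K) (hf : PolyApprox K f) (hg : PolyApprox K g) :
    PolyApprox K (fun z => f z * g z) := by
  obtain ⟨A, hA, hfA⟩ := hf.bdd hK
  intro ε hε
  obtain ⟨Q, hQ⟩ := hg (ε / (2 * A)) (by positivity)
  obtain ⟨B, hB, hQB⟩ := (poly (K := K) Q).bdd hK
  obtain ⟨P, hP⟩ := hf (ε / (2 * B)) (by positivity)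
  refine ⟨P * Q, fun s hs => ?_⟩
  have h1 := hP s hs
  have h2 := hQ s hs
  calc ‖f s * g s - (P * Q).eval s‖
      = ‖f s * (g s - Q.eval s) + (f s - P.eval s) * Q.eval s‖ := by
        congr 1; simp; ring
    _ ≤ ‖f s‖ * ‖g s - Q.eval s‖ + ‖f s - P.eval s‖ * ‖Q.eval s‖ := by
        refine (norm_add_le _ _).trans ?_
        rw [norm_mul, norm_mul]
    _ ≤ A * ‖g s - Q.eval s‖ + ‖f s - P.eval s‖ * B := by
        gcongr
        · exact hfA s hs
        · exact hQB s hs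
    _ < A * (ε / (2 * A)) + (ε / (2 * B)) * B := by gcongr
    _ = ε := by field_simp; ring

theorem smul (hK : IsCompact K) (c : ℂ) (hf : PolyApprox K f) : PolyApprox K (fun z => c * f z) :=
  mul hK (const c) hf

theorem sub (hK : IsCompact K) (hf : PolyApprox K f) (hg : PolyApprox K g) :
    PolyApprox K (fun z => f z - g z) :=
  (hf.add (hg.smul hK (-1))).congr (fun z _ => by ring)

theorem pow (hK : IsCompact K) (hf : PolyApprox K f) (n : ℕ) : PolyApprox K (fun z => f z ^ n) := by
  induction n with
  | zero => simpa using const 1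
  | succ n ih => exact (ih.mul hK hf).congr (fun z _ => by ring)

theorem sum {ι : Type*} (t : Finset ι) {F : ι → ℂ → ℂ} (h : ∀ i ∈ t, PolyApprox K (F i)) :
    PolyApprox K (fun z => ∑ i ∈ t, F i z) := by
  classical
  induction t using Finset.induction_on with
  | empty => simpa using const 0
  | insert a s ha ih =>
    refine ((h a (by simp)).add (ih fun i hi => h i (by simp [hi]))).congr fun z _ => ?_
    rw [Finset.sum_insert ha]

theorem comp (hK : IsCompact K) {u F : ℂ → ℂ} (hu : PolyApprox K u) (hu2 : ∀ z ∈ K, ‖u z‖ ≤ 1 / 2)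
    (hF : DifferentiableOn ℂ F (Metric.ball 0 1)) : PolyApprox K (fun z => F (u z)) := by
  have h1 : DifferentiableOn ℂ F (Metric.closedBall 0 ((3 / 4 : NNReal) : ℝ)) :=
    hF.mono (Metric.closedBall_subset_ball (by norm_num))
  have h2 := h1.hasFPowerSeriesOnBall (by norm_num)
  have h3 := h2.tendstoUniformlyOn (r' := 2 / 3) (by
    norm_cast
    rw [← NNReal.coe_lt_coe]; norm_num)
  rw [Metric.tendstoUniformlyOn_iff] at h3
  refine of_approx fun ε hε => ?_
  obtain ⟨n, hn⟩ := (h3 ε hε).exists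
  refine ⟨fun z => (cauchyPowerSeries F 0 ((3 / 4 : NNReal) : ℝ)).partialSum n (u z), ?_, ?_⟩
  · simp only [FormalMultilinearSeries.partialSum]
    refine sum _ fun i _ => ?_
    simp only [FormalMultilinearSeries.apply_eq_pow_smul_coeff, smul_eq_mul]
    exact (hu.pow hK i).mul hK (const _)
  · intro z hz
    have := hn (u z) (by
      have := hu2 z hz
      simp only [Metric.mem_ball, dist_zero_right]
      push_cast
      linarith)
    simpa [dist_eq_norm] using this

end PolyApprox

theorem PolyApprox.inv_step {K : Set ℂ} (hK : IsCompact K) {a b : ℂ}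
    (ha : a ∉ K) (hab : ∀ z ∈ K, 2 * ‖b - a‖ ≤ ‖z - a‖)
    (h : PolyApprox K (fun z => (z - a)⁻¹)) : PolyApprox K (fun z => (z - b)⁻¹) := by
  have h1 : PolyApprox K (fun z => (b - a) * (z - a)⁻¹) := h.smul hK _
  have h2 := h1.comp hK (F := fun u => (1 - u)⁻¹) (fun z hz => by
    have hza : 0 < ‖z - a‖ := norm_pos_iff.2 (sub_ne_zero.2 (fun e => ha (e ▸ hz)))
    have := hab z hz
    rw [norm_mul, norm_inv, ← div_eq_mul_inv, div_le_iff₀ hza]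
    linarith) (by
    refine DifferentiableOn.inv (by fun_prop) fun u hu h0 => ?_
    have : u = 1 := by linear_combination -h0
    simp [this] at hu)
  refine (h.mul hK h2).congr fun z hz => ?_
  have hza : z - a ≠ 0 := sub_ne_zero.2 (fun e => ha (e ▸ hz))
  rw [← mul_inv]
  congr 1
  field_simp
  ring

theorem exists_far_of_mem_compl {K : Set ℂ} (hK : IsCompact K) {q : ℂ} (hq : q ∉ K) :
    ∃ ε > 0, ∀ a ∈ Metric.ball q ε, a ∉ K ∧ ∀ b ∈ Metric.ball q ε,
      ∀ z ∈ K, 2 * ‖b - a‖ ≤ ‖z - a‖ := by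
  obtain ⟨ε, hε, h⟩ := Metric.isOpen_iff.1 hK.isClosed.isOpen_compl q hq
  refine ⟨ε / 8, by positivity, fun a ha => ⟨?_, fun b hb z hz => ?_⟩⟩
  · exact h (Metric.ball_subset_ball (by linarith) ha)
  · have h1 : ε ≤ ‖z - q‖ := by
      by_contra! h2
      exact h (by simpa [dist_eq_norm] using h2) hz
    simp only [Metric.mem_ball, dist_eq_norm] at ha hb
    have h2 : ‖b - a‖ ≤ ‖b - q‖ + ‖a - q‖ := by
      have := norm_sub_le (b - q) (a - q); simpa using this
    have h3 : ‖z - q‖ ≤ ‖z - a‖ + ‖a - q‖ := by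
      have := norm_add_le (z - a) (a - q); simpa using this
    linarith

/-- A nonempty subset of `Kᶜ` closed under local propagation is everything. -/
theorem propagate {K : Set ℂ} (hKc : IsConnected Kᶜ) (V : Set ℂ)
    (hVK : V ⊆ Kᶜ) (hV : V.Nonempty)
    (h : ∀ q ∉ K, (q ∈ closure V) → ∃ ε > 0, ∀ a ∈ Metric.ball q ε, ∀ b ∈ Metric.ball q ε,
      a ∈ V → b ∈ V) : Kᶜ ⊆ V := by
  have hmem : ∀ q ∉ K, q ∈ closure V → V ∈ nhds q := by
    intro q hq hqV
    obtain ⟨ε, hε, H⟩ := h q hq hqV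
    obtain ⟨a, haV, ha⟩ := Metric.mem_closure_iff.1 hqV ε hε
    exact Filter.mem_of_superset (Metric.ball_mem_nhds q hε)
      fun b hb => H a (by rwa [Metric.mem_ball, dist_comm]) b hb haV
  refine hKc.isPreconnected.subset_of_closure_inter_subset ?_ ?_ ?_
  · rw [isOpen_iff_mem_nhds]
    exact fun q hq => hmem q (hVK hq) (subset_closure hq)
  · obtain ⟨a, ha⟩ := hV
    exact ⟨a, hVK ha, ha⟩
  · rintro q ⟨h1, h2⟩
    exact mem_of_mem_nhds (hmem q h2 h1)

theorem PolyApprox.inv {K : Set ℂ} (hK : IsCompact K) (hKc : IsConnected Kᶜ) {a : ℂ}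
    (ha : a ∉ K) : PolyApprox K (fun z => (z - a)⁻¹) := by
  have key := propagate hKc {a | a ∉ K ∧ PolyApprox K (fun z => (z - a)⁻¹)}
    (fun a ha => ha.1) ?_ ?_
  · exact (key ha).2
  · obtain ⟨C, hC⟩ := hK.isBounded.exists_norm_le
    obtain ⟨R, hR, hR1⟩ : ∃ R : ℝ, 0 < R ∧ 2 * C ≤ R := ⟨2 * |C| + 1, by positivity, by
      linarith [le_abs_self C]⟩
    have hRc : (R : ℂ) ≠ 0 := by exact_mod_cast hR.ne'
    have hR2 : ∀ z ∈ K, ‖(R : ℂ)⁻¹ * z‖ ≤ 1 / 2 := fun z hz => by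
      have := hC z hz
      rw [norm_mul, norm_inv, Complex.norm_real, Real.norm_eq_abs, abs_of_pos hR, ← div_eq_inv_mul,
        div_le_iff₀ hR]
      linarith
    refine ⟨R, fun hz => ?_, ?_⟩
    · have := hR2 _ hz
      rw [inv_mul_cancel₀ hRc] at this
      norm_num at this
    · have h2 := (PolyApprox.id.smul hK (R : ℂ)⁻¹).comp hK (F := fun u => (1 - u)⁻¹) hR2 (by
        refine DifferentiableOn.inv (by fun_prop) fun u hu h0 => ?_
        have : u = 1 := by linear_combination -h0
        simp [this] at hu)
      refine (h2.smul hK (-(R : ℂ)⁻¹)).congr fun z hz => ?_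
      rw [← inv_neg, ← mul_inv]
      congr 1
      field_simp
      ring
  · intro q hq _
    obtain ⟨ε, hε, H⟩ := exists_far_of_mem_compl hK hq
    refine ⟨ε, hε, fun a ha b hb haV => ⟨(H b hb).1, ?_⟩⟩
    exact haV.2.inv_step hK (H a ha).1 ((H a ha).2 b hb)

theorem PolyApprox.sqrt_step {K : Set ℂ} (hK : IsCompact K) (hKc : IsConnected Kᶜ) {a b : ℂ}
    (hb : b ∉ K) (hab : ∀ z ∈ K, 2 * ‖a - b‖ ≤ ‖z - b‖) :
    ∃ s, PolyApprox K s ∧ ∀ z ∈ K, s z ^ 2 * (z - b) = z - a ∧ 0 < (s z).re := by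
  have hslit : ∀ u : ℂ, ‖u‖ < 1 → 1 + u ∈ Complex.slitPlane := fun u hu => by
    left
    have := (abs_le.1 (Complex.abs_re_le_norm u)).1
    simp only [Complex.add_re, Complex.one_re]
    linarith
  have hu2 : ∀ z ∈ K, ‖(b - a) * (z - b)⁻¹‖ ≤ 1 / 2 := fun z hz => by
    have hza : 0 < ‖z - b‖ := norm_pos_iff.2 (sub_ne_zero.2 (fun e => hb (e ▸ hz)))
    have := hab z hz
    rw [norm_mul, norm_inv, ← div_eq_mul_inv, div_le_iff₀ hza, norm_sub_rev]
    linarith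
  have h2 := ((PolyApprox.inv hK hKc hb).smul hK (b - a)).comp hK
    (F := fun u => Complex.exp (Complex.log (1 + u) / 2)) hu2 (by
      refine DifferentiableOn.cexp (DifferentiableOn.div_const ?_ _)
      refine DifferentiableOn.clog (by fun_prop) fun u hu => hslit u (by simpa using hu))
  refine ⟨_, h2, fun z hz => ?_⟩
  have hzb : z - b ≠ 0 := sub_ne_zero.2 (fun e => hb (e ▸ hz))
  have hs := hslit _ ((hu2 z hz).trans_lt (by norm_num))
  constructor
  · rw [← Complex.exp_nat_mul]
    have : ((2 : ℕ) : ℂ) * (Complex.log (1 + (b - a) * (z - b)⁻¹) / 2)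
      = Complex.log (1 + (b - a) * (z - b)⁻¹) := by push_cast; ring
    rw [this, Complex.exp_log (Complex.slitPlane_ne_zero hs)]
    field_simp
    ring
  · rw [Complex.exp_re]
    refine mul_pos (Real.exp_pos _) (Real.cos_pos_of_mem_Ioo ?_)
    have h1 := Complex.neg_pi_lt_arg (1 + (b - a) * (z - b)⁻¹)
    have h3 := Complex.arg_le_pi (1 + (b - a) * (z - b)⁻¹)
    have h4 := (Complex.mem_slitPlane_iff_arg.1 hs).1
    have h5 := lt_of_le_of_ne h3 h4
    have : (Complex.log (1 + (b - a) * (z - b)⁻¹) / 2).im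
      = Complex.arg (1 + (b - a) * (z - b)⁻¹) / 2 := by
      rw [show (2 : ℂ) = ((2 : ℝ) : ℂ) by norm_num, Complex.div_ofReal_im, Complex.log_im]
    rw [this]
    constructor <;> linarith

theorem sqrt_near_one {s z a b : ℂ} (hs : 0 < s.re) (h : s ^ 2 * (z - b) = z - a) :
    ‖s - 1‖ * ‖z - b‖ ≤ ‖b - a‖ := by
  have h1 : (s - 1) * (s + 1) * (z - b) = b - a := by linear_combination h
  have h2 : 1 ≤ ‖s + 1‖ := by
    have := (Complex.re_le_norm (s + 1))
    simp only [Complex.add_re, Complex.one_re] at this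
    linarith
  rw [← h1, norm_mul, norm_mul]
  nlinarith [mul_nonneg (norm_nonneg (s - 1)) (norm_nonneg (z - b))]

theorem exists_sqrt {K : Set ℂ} (hK : IsCompact K) (hKc : IsConnected Kᶜ) {p : ℂ}
    (hp : p ∉ K) {r : ℝ} (hr : 0 < r) :
    ∃ b, ‖b - p‖ < r ∧ r / 2 ≤ ‖b - p‖ ∧ ∃ s, PolyApprox K s ∧
      (∀ z ∈ K, s z ^ 2 * (z - b) = z - p) ∧ ∀ z ∈ K, 9 * r ≤ ‖z - p‖ → 0 < (s z).re := by
  set V : Set ℂ := {b | ‖b - p‖ < r ∧ b ∉ K ∧ ∃ s, PolyApprox K s ∧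
      (∀ z ∈ K, s z ^ 2 * (z - b) = z - p) ∧ ∀ z ∈ K, 9 * r ≤ ‖z - p‖ → 0 < (s z).re} with hVdef
  by_contra hcon
  have hV : ∀ b ∈ V, ‖b - p‖ < r / 2 := by
    intro b hb
    by_contra! h
    exact hcon ⟨b, hb.1, h, hb.2.2⟩
  have key : Kᶜ ⊆ V := by
    refine propagate hKc V (fun b hb => hb.2.1) ⟨p, by simpa using hr, hp, fun _ => 1,
      PolyApprox.const 1, by simp, by simp⟩ ?_
    intro q hq hqV
    have hqp : ‖q - p‖ ≤ r / 2 := by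
      have : closure V ⊆ Metric.closedBall p (r / 2) :=
        closure_minimal (fun b hb => by simpa [dist_eq_norm] using (hV b hb).le)
          Metric.isClosed_closedBall
      simpa [dist_eq_norm] using this hqV
    obtain ⟨ε, hε, H⟩ := exists_far_of_mem_compl hK hq
    refine ⟨min ε (r / 2), by positivity, fun a ha b hb haV => ?_⟩
    have ha' := Metric.ball_subset_ball (min_le_left _ _) ha
    have hb' := Metric.ball_subset_ball (min_le_left _ _) hb
    have hbp : ‖b - p‖ < r := by
      have h1 := Metric.ball_subset_ball (min_le_right _ _) hb
      rw [Metric.mem_ball, dist_eq_norm] at h1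
      have := norm_add_le (b - q) (q - p)
      simp only [sub_add_sub_cancel] at this
      linarith
    obtain ⟨hap, haK, s, hs, hs1, hs2⟩ := haV
    obtain ⟨t, ht, ht1⟩ := PolyApprox.sqrt_step hK hKc (H b hb').1 ((H b hb').2 a ha')
    refine ⟨hbp, (H b hb').1, _, hs.mul hK ht, fun z hz => ?_, fun z hz hzp => ?_⟩
    · have e1 := hs1 z hz
      have e2 := (ht1 z hz).1
      linear_combination e1 + s z ^ 2 * e2
    · have e1 := sqrt_near_one (hs2 z hz hzp) (hs1 z hz)
      have e2 := sqrt_near_one (ht1 z hz).2 (ht1 z hz).1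
      have hza : 8 * r ≤ ‖z - a‖ := by
        have := norm_add_le (z - a) (a - p)
        simp only [sub_add_sub_cancel] at this
        linarith
      have hzb : 8 * r ≤ ‖z - b‖ := by
        have := norm_add_le (z - b) (b - p)
        simp only [sub_add_sub_cancel] at this
        linarith
      have hba : ‖b - a‖ ≤ 2 * r := by
        have := norm_sub_le (b - p) (a - p)
        simp only [sub_sub_sub_cancel_right] at this
        linarith
      have f1 : ‖s z - 1‖ ≤ 1 / 4 := by
        by_contra! h
        nlinarith
      have f2 : ‖t z - 1‖ ≤ 1 / 4 := by
        by_contra! h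
        nlinarith
      have f3 : ‖s z * t z - 1‖ ≤ 9 / 16 := by
        calc ‖s z * t z - 1‖ = ‖(s z - 1) * (t z - 1) + (s z - 1) + (t z - 1)‖ := by
              congr 1; ring
          _ ≤ ‖s z - 1‖ * ‖t z - 1‖ + ‖s z - 1‖ + ‖t z - 1‖ := by
              refine (norm_add₃_le).trans ?_
              rw [norm_mul]
          _ ≤ 1 / 4 * (1 / 4) + 1 / 4 + 1 / 4 := by gcongr
          _ = 9 / 16 := by norm_num
      have f4 := (abs_le.1 (Complex.abs_re_le_norm (s z * t z - 1))).1
      simp only [Complex.sub_re, Complex.one_re] at f4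
      linarith
  have hbdd : Bornology.IsBounded (Set.univ : Set ℂ) := by
    refine (hK.isBounded.union (Metric.isBounded_ball (x := p) (r := r))).subset fun z _ => ?_
    by_cases hz : z ∈ K
    · exact Or.inl hz
    · exact Or.inr (by simpa [dist_eq_norm] using (key hz).1)
  exact NormedSpace.unbounded_univ ℝ ℂ hbdd

theorem exists_kernel : ∃ C : ℝ, 0 < C ∧ ∀ K : Set ℂ, IsCompact K → IsConnected Kᶜ →
    ∀ p ∉ K, ∀ r : ℝ, 0 < r → ∃ c : ℂ, ∃ g : ℂ → ℂ, PolyApprox K g ∧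
      ∀ z ∈ K, ∀ ζ ∈ Metric.ball p r,
        ‖(z - ζ) * (g z + (ζ - c) * g z ^ 2) - 1‖ ≤ C ∧
        ‖(z - ζ) * (g z + (ζ - c) * g z ^ 2) - 1‖ * ‖z - ζ‖ ^ 2 ≤ C * r ^ 2 := by
  refine ⟨100 * 30000 ^ 2, by norm_num, fun K hK hKc p hp r hr => ?_⟩
  obtain ⟨b, hb1, hb2, s, hs, hs1, hs2⟩ := exists_sqrt hK hKc hp hr
  set c := (p + b) / 2 with hc
  set l := (b - p) / 2 with hl
  have hln : ‖l‖ = ‖b - p‖ / 2 := by rw [hl, norm_div]; simp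
  have hl0 : l ≠ 0 := by rw [← norm_pos_iff, hln]; linarith
  have hcp : c - p = l := by rw [hc, hl]; ring
  have hbc : b - c = l := by rw [hc, hl]; ring
  set w : ℂ → ℂ := fun z => (z - c) - (z - b) * s z with hw
  have hwK : PolyApprox K w :=
    (PolyApprox.id.sub hK (.const c)).sub hK ((PolyApprox.id.sub hK (.const b)).mul hK hs)
  have hwbd : ∀ z ∈ K, ‖w z‖ ≤ 20 * r := by
    intro z hz
    have hzb : ‖z - b‖ ≤ ‖z - p‖ + ‖b - p‖ := by
      have := norm_sub_le (z - p) (b - p)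
      simpa using this
    by_cases hzp : 9 * r ≤ ‖z - p‖
    · have e := sqrt_near_one (hs2 z hz hzp) (hs1 z hz)
      have : w z = l - (s z - 1) * (z - b) := by rw [← hbc]; simp only [hw]; ring
      rw [this]
      refine (norm_sub_le _ _).trans ?_
      rw [norm_mul]
      linarith
    · push Not at hzp
      have h1 : ‖z - c‖ ≤ 10 * r := by
        have := norm_sub_le (z - p) (c - p)
        rw [sub_sub_sub_cancel_right, hcp] at this
        linarith
      have h2 : ‖(z - b) * s z‖ ≤ 10 * r := by
        refine abs_le_of_sq_le_sq' ?_ (by positivity) |>.2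
        have : ((z - b) * s z) ^ 2 = (z - p) * (z - b) := by
          linear_combination (z - b) * hs1 z hz
        rw [← norm_pow, this, norm_mul]
        nlinarith [norm_nonneg (z - b), norm_nonneg (z - p)]
      exact (norm_sub_le _ _).trans (by linarith)
  have hweq : ∀ z ∈ K, w z ^ 2 + l ^ 2 = 2 * (z - c) * w z := by
    intro z hz
    have h3 : (z - c) ^ 2 - l ^ 2 = (z - p) * (z - b) := by rw [hc, hl]; ring
    have : ((z - b) * s z) ^ 2 = (z - p) * (z - b) := by
      linear_combination (z - b) * hs1 z hz
    simp only [hw]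
    linear_combination this - h3
  refine ⟨c, fun z => (2 / l ^ 2) * w z, hwK.smul hK _, fun z hz ζ hζ => ?_⟩
  set g := (2 / l ^ 2) * w z with hg
  have hgeq : (z - c) * g = 1 + l ^ 2 * g ^ 2 / 4 := by
    have := hweq z hz
    rw [hg]
    field_simp
    linear_combination -4 * this
  have hgr : ‖g‖ * r ≤ 640 := by
    have h1 := hwbd z hz
    have h2 : r ^ 2 / 16 ≤ ‖l‖ ^ 2 := by rw [hln]; nlinarith
    have h3 : ‖g‖ * ‖l‖ ^ 2 = 2 * ‖w z‖ := by
      rw [← norm_pow, ← norm_mul, hg]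
      have : 2 / l ^ 2 * w z * l ^ 2 = 2 * w z := by field_simp
      rw [this, norm_mul]; simp
    have h4 : ‖g‖ * (r ^ 2 / 16) ≤ 40 * r := by
      calc _ ≤ ‖g‖ * ‖l‖ ^ 2 := by gcongr
        _ ≤ _ := by linarith
    by_contra! h
    nlinarith
  have hζ' : ‖ζ - c‖ ≤ 2 * r := by
    rw [Metric.mem_ball, dist_eq_norm] at hζ
    have := norm_sub_le (ζ - p) (c - p)
    rw [sub_sub_sub_cancel_right, hcp] at this
    linarith
  have hlr : ‖l‖ ≤ r / 2 := by linarith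
  have hlg : ‖l‖ * ‖g‖ ≤ 320 := by nlinarith [norm_nonneg g]
  have hid : (z - ζ) * (g + (ζ - c) * g ^ 2) - 1
      = l ^ 2 * g ^ 2 / 4 + (ζ - c) * g * (l ^ 2 * g ^ 2 / 4) - (ζ - c) ^ 2 * g ^ 2 := by
    linear_combination (1 + (ζ - c) * g) * hgeq
  have hζg : ‖ζ - c‖ * ‖g‖ ≤ 1280 := by nlinarith [norm_nonneg g]
  have hmain : ‖(z - ζ) * (g + (ζ - c) * g ^ 2) - 1‖ ≤ 100 * (r * ‖g‖) ^ 2 := by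
    rw [hid]
    calc _ ≤ ‖l‖ ^ 2 * ‖g‖ ^ 2 / 4 + ‖ζ - c‖ * ‖g‖ * (‖l‖ ^ 2 * ‖g‖ ^ 2 / 4)
          + ‖ζ - c‖ ^ 2 * ‖g‖ ^ 2 := by
          refine (norm_sub_le _ _).trans (add_le_add ((norm_add_le _ _).trans ?_) ?_)
          · simp
          · simp
      _ ≤ (r / 2) ^ 2 * ‖g‖ ^ 2 / 4 + 1280 * ((r / 2) ^ 2 * ‖g‖ ^ 2 / 4)
          + (2 * r) ^ 2 * ‖g‖ ^ 2 := by gcongr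
      _ ≤ _ := by nlinarith [sq_nonneg (r * ‖g‖)]
  have hzg : ‖g‖ * ‖z - ζ‖ ≤ 30000 := by
    have h1 : ‖z - c‖ * ‖g‖ ≤ 1 + (‖l‖ * ‖g‖) ^ 2 / 4 := by
      rw [← norm_mul, hgeq]
      refine (norm_add_le _ _).trans ?_
      simp [mul_pow]
    have h2 : ‖z - ζ‖ ≤ ‖z - c‖ + ‖ζ - c‖ := by
      have := norm_sub_le (z - c) (ζ - c)
      simpa using this
    nlinarith [norm_nonneg g, norm_nonneg l, mul_nonneg (norm_nonneg l) (norm_nonneg g)]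
  have hgr' : r * ‖g‖ ≤ 640 := by linarith
  constructor
  · refine hmain.trans ?_
    have : (r * ‖g‖) ^ 2 ≤ 640 ^ 2 := by gcongr
    linarith
  · calc _ ≤ 100 * (r * ‖g‖) ^ 2 * ‖z - ζ‖ ^ 2 := by gcongr
      _ = 100 * r ^ 2 * (‖g‖ * ‖z - ζ‖) ^ 2 := by ring
      _ ≤ 100 * r ^ 2 * 30000 ^ 2 := by gcongr
      _ = _ := by ring

open MeasureTheory Set Metric in
theorem polar_ball (G : ℂ → ℂ) (hGm : Measurable G) (δ : ℝ)
    (hint : IntegrableOn (fun w => w * G w) (ball 0 δ)) :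
    ∫ w in ball 0 δ, w * G w
      = ∫ ρ in Ioo 0 δ, (ρ : ℂ) * (-Complex.I * ∮ w in C(0, ρ), G w) := by
  set F : ℂ → ℂ := (ball 0 δ).indicator (fun w => w * G w) with hF
  have hFm : Measurable F := (measurable_id.mul hGm).indicator measurableSet_ball
  have hFi : Integrable F := (integrable_indicator_iff measurableSet_ball).2 hint
  have hcirc : ∀ p : ℝ × ℝ, Complex.polarCoord.symm p = circleMap 0 p.1 p.2 := by
    intro p
    simp [circleMap, Complex.exp_mul_I]
  have hcm : Measurable (fun p : ℝ × ℝ => circleMap 0 p.1 p.2) := by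
    unfold circleMap
    fun_prop
  have hm : Measurable (fun p : ℝ × ℝ => p.1 • F (Complex.polarCoord.symm p)) := by
    simp_rw [hcirc]
    exact measurable_fst.smul (hFm.comp hcm)
  have hpi : IntegrableOn (fun p : ℝ × ℝ => p.1 • F (Complex.polarCoord.symm p))
      (Ioi (0 : ℝ) ×ˢ Ioo (-Real.pi) Real.pi) := by
    refine ⟨hm.aestronglyMeasurable, ?_⟩
    have h1 := Complex.lintegral_comp_polarCoord_symm (fun z => ‖F z‖ₑ)
    have h2 := hFi.2
    unfold HasFiniteIntegral at h2 ⊢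
    rw [← h1, polarCoord_target] at h2
    refine lt_of_le_of_lt (le_of_eq ?_) h2
    refine setLIntegral_congr_fun (measurableSet_Ioi.prod measurableSet_Ioo) fun p hp => ?_
    have hp1 : (0 : ℝ) < p.1 := hp.1
    simp only [enorm_smul, smul_eq_mul]
    rw [Real.enorm_eq_ofReal hp1.le]
  rw [← integral_indicator measurableSet_ball, ← hF, ← Complex.integral_comp_polarCoord_symm,
    polarCoord_target, Measure.volume_eq_prod, setIntegral_prod _ hpi]
  rw [show Ioo (0 : ℝ) δ = Ioi 0 ∩ Iio δ from rfl, ← setIntegral_indicator measurableSet_Iio]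
  refine setIntegral_congr_fun measurableSet_Ioi fun ρ hρ => ?_
  have hρ' : (0 : ℝ) < ρ := hρ
  simp only [hcirc]
  by_cases hρδ : ρ < δ
  · rw [indicator_of_mem (show ρ ∈ Iio δ from hρδ)]
    have hFe : ∀ θ : ℝ, F (circleMap 0 ρ θ) = circleMap 0 ρ θ * G (circleMap 0 ρ θ) := by
      intro θ
      rw [hF, indicator_of_mem]
      simp [abs_of_pos hρ', hρδ]
    simp only [hFe, Complex.real_smul]
    rw [← integral_Ioc_eq_integral_Ioo, ← intervalIntegral.integral_of_le (by
      linarith [Real.pi_pos])]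
    have hper : Function.Periodic (fun θ : ℝ => circleMap 0 ρ θ * G (circleMap 0 ρ θ))
        (2 * Real.pi) := fun θ => by
      simp only [periodic_circleMap 0 ρ θ]
    have h3 := hper.intervalIntegral_add_eq (-Real.pi) 0
    rw [show -Real.pi + 2 * Real.pi = Real.pi by ring, zero_add] at h3
    rw [intervalIntegral.integral_const_mul, h3]
    congr 1
    rw [circleIntegral, ← intervalIntegral.integral_const_mul]
    refine intervalIntegral.integral_congr fun θ _ => ?_
    simp only [deriv_circleMap, smul_eq_mul]
    linear_combination (circleMap 0 ρ θ * G (circleMap 0 ρ θ)) * Complex.I_mul_I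
  · rw [indicator_of_notMem (show ρ ∉ Iio δ from hρδ)]
    have hFe : ∀ θ : ℝ, F (circleMap 0 ρ θ) = 0 := by
      intro θ
      rw [hF, indicator_of_notMem]
      simpa [abs_of_pos hρ'] using hρδ
    simp [hFe]

open MeasureTheory Set Metric in
theorem integrableOn_inv_norm (T : ℝ) : IntegrableOn (fun v : ℂ => ‖v‖⁻¹) (ball 0 T) := by
  rw [integrableOn_fun_norm_addHaar volume (f := fun y : ℝ => y⁻¹)]
  have : IntegrableOn (fun _ : ℝ => (1 : ℝ)) (Ioo 0 T) := by simp
  refine this.congr_fun (fun y hy => ?_) measurableSet_Ioo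
  have : y ≠ 0 := hy.1.ne'
  simp [this]

open MeasureTheory Set Metric in
theorem integrableOn_inv_sub (δ : ℝ) (v : ℂ) :
    IntegrableOn (fun w : ℂ => (v - w)⁻¹) (ball 0 δ) := by
  have h1 := (integrable_indicator_iff measurableSet_ball).2 (integrableOn_inv_norm (δ + ‖v‖))
  have h2 := (h1.comp_sub_left v).integrableOn (s := ball 0 δ)
  refine h2.mono' (by fun_prop) ?_
  refine (ae_restrict_iff' measurableSet_ball).2 (.of_forall fun w hw => ?_)
  rw [indicator_of_mem]
  · simp
  · simp only [mem_ball, dist_zero_right] at hw ⊢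
    linarith [norm_sub_le v w]

open MeasureTheory Set Metric in
theorem integral_ball_kernel {δ : ℝ} (hδ : 0 < δ) (v : ℂ) :
    ∫ w in ball 0 δ, w * (v - w)⁻¹ = -Real.pi * (max 0 (δ ^ 2 - ‖v‖ ^ 2) : ℝ) := by
  have hint : IntegrableOn (fun w => w * (v - w)⁻¹) (ball 0 δ) := by
    refine ((integrableOn_inv_sub δ v).norm.const_mul δ).mono' (by fun_prop) ?_
    refine (ae_restrict_iff' measurableSet_ball).2 (.of_forall fun w hw => ?_)
    simp only [mem_ball, dist_zero_right] at hw
    rw [norm_mul]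
    gcongr
  rw [polar_ball (fun w => (v - w)⁻¹) (by fun_prop) δ hint]
  have hneg : ∀ ρ : ℝ, (∮ w in C(0, ρ), (v - w)⁻¹) = - ∮ w in C(0, ρ), (w - v)⁻¹ := by
    intro ρ
    simp only [circleIntegral, ← intervalIntegral.integral_neg]
    congr 1
    ext θ
    rw [← smul_neg, ← inv_neg, neg_sub]
  have hcases : ∀ ρ ∈ Ioo (0 : ℝ) δ, ρ ≠ ‖v‖ →
      (ρ : ℂ) * (-Complex.I * ∮ w in C(0, ρ), (v - w)⁻¹)
        = (Ioi ‖v‖).indicator (fun ρ : ℝ => (((-2 * Real.pi) * ρ : ℝ) : ℂ)) ρ := by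
    intro ρ hρ hne
    rw [hneg]
    rcases lt_or_gt_of_ne hne with h | h
    · rw [indicator_of_notMem (by simpa using h.le)]
      have : DiffContOnCl ℂ (fun w => (w - v)⁻¹) (ball 0 ρ) := by
        refine DifferentiableOn.diffContOnCl (DifferentiableOn.inv (by fun_prop) ?_)
        intro x hx h0
        have : x ∈ closedBall (0 : ℂ) ρ := closure_ball_subset_closedBall hx
        rw [sub_eq_zero.1 h0] at this
        simp at this
        linarith
      rw [this.circleIntegral_eq_zero hρ.1.le]
      simp
    · rw [indicator_of_mem (show ρ ∈ Ioi ‖v‖ from h),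
        circleIntegral.integral_sub_inv_of_mem_ball (by simpa using h)]
      push_cast
      linear_combination (2 * Real.pi * ρ) * Complex.I_mul_I
  have hae : ∀ᵐ ρ : ℝ, ρ ≠ ‖v‖ := by
    have := Set.Countable.ae_notMem (countable_singleton ‖v‖) (volume : Measure ℝ)
    simpa using this
  rw [setIntegral_congr_ae (g := (Ioi ‖v‖).indicator
      (fun ρ : ℝ => (((-2 * Real.pi) * ρ : ℝ) : ℂ))) measurableSet_Ioo
      (hae.mono fun ρ h1 h2 => hcases ρ h2 h1), setIntegral_indicator measurableSet_Ioi]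
  have hset : Ioo 0 δ ∩ Ioi ‖v‖ = Ioo ‖v‖ δ := by
    ext x
    simp only [mem_inter_iff, mem_Ioo, mem_Ioi]
    have := norm_nonneg v
    constructor
    · rintro ⟨⟨_, _⟩, _⟩; constructor <;> linarith
    · rintro ⟨_, _⟩; refine ⟨⟨?_, ?_⟩, ?_⟩ <;> linarith
  rw [hset]
  rcases le_or_gt δ ‖v‖ with h | h
  · rw [Ioo_eq_empty (by simpa using h), max_eq_left (by nlinarith)]
    simp
  · rw [← integral_Ioc_eq_integral_Ioo, ← intervalIntegral.integral_of_le h.le,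
      intervalIntegral.integral_ofReal, max_eq_right (by nlinarith [norm_nonneg v]),
      intervalIntegral.integral_const_mul, integral_id]
    push_cast
    ring

open MeasureTheory Set Metric in
theorem integral_bump {δ : ℝ} (hδ : 0 < δ) :
    ∫ v : ℂ, max 0 (δ ^ 2 - ‖v‖ ^ 2) = Real.pi * δ ^ 4 / 2 := by
  rw [integral_fun_norm_addHaar volume (fun y : ℝ => max 0 (δ ^ 2 - y ^ 2))]
  have h1 : ∫ y in Ioi (0 : ℝ), y ^ (Module.finrank ℝ ℂ - 1) • max 0 (δ ^ 2 - y ^ 2)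
      = ∫ y in (0 : ℝ)..δ, (δ ^ 2 * y - y ^ 3) := by
    rw [intervalIntegral.integral_of_le hδ.le, ← Ioi_inter_Iic,
      ← setIntegral_indicator measurableSet_Iic]
    refine setIntegral_congr_fun measurableSet_Ioi fun y hy => ?_
    have hy' : (0 : ℝ) < y := hy
    by_cases h : y ≤ δ
    · simp only [Complex.finrank_real_complex]
      rw [indicator_of_mem (show y ∈ Iic δ from h), max_eq_right (by nlinarith)]
      simp; ring
    · simp only [Complex.finrank_real_complex]
      rw [indicator_of_notMem (show y ∉ Iic δ from h), max_eq_left (by nlinarith)]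
      simp
  rw [h1, intervalIntegral.integral_sub
    (Continuous.intervalIntegrable (by fun_prop) _ _)
    (Continuous.intervalIntegrable (by fun_prop) _ _),
    intervalIntegral.integral_const_mul, integral_id, integral_pow]
  simp [Measure.real, Complex.volume_ball]
  ring

open MeasureTheory Set Metric in
theorem integrable_decay {r : ℝ} (hr : 0 < r) :
    Integrable (fun v : ℂ => (1 + (‖v‖ / r) ^ 2)⁻¹ * ‖v‖⁻¹) ∧
    ∫ v : ℂ, (1 + (‖v‖ / r) ^ 2)⁻¹ * ‖v‖⁻¹ = Real.pi ^ 2 * r := by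
  have h0 : ∀ y ∈ Ioi (0 : ℝ), y ^ (Module.finrank ℝ ℂ - 1) • ((1 + (y / r) ^ 2)⁻¹ * y⁻¹)
      = (1 + (r⁻¹ * y) ^ 2)⁻¹ := by
    intro y hy
    have hy' : y ≠ 0 := (show (0 : ℝ) < y from hy).ne'
    simp only [Complex.finrank_real_complex]
    rw [div_eq_inv_mul]
    simp
    field_simp
  constructor
  · rw [integrable_fun_norm_addHaar volume (f := fun y : ℝ => (1 + (y / r) ^ 2)⁻¹ * y⁻¹)]
    rw [integrableOn_congr_fun h0 measurableSet_Ioi]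
    have := (integrable_inv_one_add_sq.comp_mul_left' (R := r⁻¹) (by positivity))
    exact this.integrableOn
  · rw [integral_fun_norm_addHaar volume (fun y : ℝ => (1 + (y / r) ^ 2)⁻¹ * y⁻¹),
      setIntegral_congr_fun measurableSet_Ioi h0,
      integral_comp_mul_left_Ioi (fun x : ℝ => (1 + x ^ 2)⁻¹) 0 (by positivity : 0 < r⁻¹)]
    simp [Measure.real, Complex.volume_ball]
    ring

open MeasureTheory Set Metric in
/-- (A multiple of) the smoothed d-bar derivative of `f`. -/
noncomputable def psiFun (f : ℂ → ℂ) (δ : ℝ) (ζ : ℂ) : ℂ := ∫ w in ball 0 δ, w * f (ζ - w)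

open MeasureTheory Set Metric in
theorem psiFun_eq (f : ℂ → ℂ) (δ : ℝ) (ζ : ℂ) :
    psiFun f δ ζ = ∫ u, (ball (0 : ℂ) δ).indicator id (ζ - u) * f u := by
  rw [psiFun, ← integral_indicator measurableSet_ball,
    ← integral_sub_left_eq_self (fun u => (ball (0 : ℂ) δ).indicator id (ζ - u) * f u) volume ζ]
  congr 1
  ext w
  simp only [sub_sub_cancel]
  by_cases h : w ∈ ball (0 : ℂ) δ <;> simp [h]

open MeasureTheory Set Metric in
theorem psiFun_measurable {f : ℂ → ℂ} (hf : Continuous f) (δ : ℝ) : Measurable (psiFun f δ) := by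
  have : psiFun f δ = fun ζ => ∫ u, (ball (0 : ℂ) δ).indicator id (ζ - u) * f u :=
    funext (psiFun_eq f δ)
  rw [this]
  have hm : Measurable (fun p : ℂ × ℂ => (ball (0 : ℂ) δ).indicator id (p.1 - p.2) * f p.2) := by
    have h1 : Measurable ((ball (0 : ℂ) δ).indicator (id : ℂ → ℂ)) :=
      measurable_id.indicator measurableSet_ball
    have h2 := hf.measurable
    fun_prop
  exact (hm.stronglyMeasurable.integral_prod_right).measurable

open MeasureTheory Set Metric in
theorem psiFun_transform {f : ℂ → ℂ} (hf : Continuous f) (hfs : HasCompactSupport f) {δ : ℝ}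
    (hδ : 0 < δ) (z : ℂ) :
    Integrable (fun ζ => psiFun f δ ζ * (z - ζ)⁻¹) ∧
    ∫ ζ, psiFun f δ ζ * (z - ζ)⁻¹
      = -Real.pi * ∫ u, f u * (max 0 (δ ^ 2 - ‖z - u‖ ^ 2) : ℝ) := by
  set H : ℂ → ℂ := (ball (0 : ℂ) δ).indicator id with hH
  have hHm : Measurable H := measurable_id.indicator measurableSet_ball
  have hHb : ∀ w, ‖H w‖ ≤ δ := by
    intro w
    by_cases h : w ∈ ball (0 : ℂ) δ
    · rw [hH, indicator_of_mem h]
      simpa using (mem_ball_zero_iff.1 h).le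
    · rw [hH, indicator_of_notMem h]
      simpa using hδ.le
  have hfm := hf.measurable
  have hfi : Integrable f := hf.integrable_of_hasCompactSupport hfs
  obtain ⟨R, hR⟩ := hfs.isCompact.isBounded.exists_norm_le
  set k : ℂ → ℝ := (ball (0 : ℂ) (‖z‖ + (R + δ))).indicator (fun v => ‖v‖⁻¹) with hk
  have hki : Integrable k := (integrable_indicator_iff measurableSet_ball).2 (integrableOn_inv_norm _)
  set N : ℂ × ℂ → ℂ := fun p => H (p.1 - p.2) * f p.2 * (z - p.1)⁻¹ with hN
  have hNi : Integrable N (volume.prod volume) := by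
    have hb : Integrable (fun p : ℂ × ℂ => (δ * k (z - p.1)) * ‖f p.2‖) (volume.prod volume) :=
      ((hki.comp_sub_left z).const_mul δ).mul_prod hfi.norm
    refine hb.mono' ?_ (.of_forall fun p => ?_)
    · have : Measurable N := by fun_prop
      exact this.aestronglyMeasurable
    · by_cases h0 : H (p.1 - p.2) * f p.2 = 0
      · simp only [hN, h0, zero_mul, norm_zero]
        have : 0 ≤ k (z - p.1) := indicator_nonneg (fun _ _ => by positivity) _
        positivity
      · have hp1 : p.1 - p.2 ∈ ball (0 : ℂ) δ := by
          by_contra h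
          exact h0 (by rw [hH, indicator_of_notMem h, zero_mul])
        have hp2 : ‖p.2‖ ≤ R := hR _ (subset_tsupport _ (right_ne_zero_of_mul h0))
        have hmem : z - p.1 ∈ ball (0 : ℂ) (‖z‖ + (R + δ)) := by
          rw [mem_ball_zero_iff] at hp1 ⊢
          have h1 := norm_sub_le z p.1
          have h2 := norm_add_le (p.1 - p.2) p.2
          rw [sub_add_cancel] at h2
          linarith
        have : k (z - p.1) = ‖z - p.1‖⁻¹ := by rw [hk, indicator_of_mem hmem]
        rw [this]
        simp only [hN, norm_mul, norm_inv]
        have := hHb (p.1 - p.2)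
        calc ‖H (p.1 - p.2)‖ * ‖f p.2‖ * ‖z - p.1‖⁻¹ ≤ δ * ‖f p.2‖ * ‖z - p.1‖⁻¹ := by gcongr
          _ = _ := by ring
  have hinner : ∀ ζ, ∫ u, N (ζ, u) = psiFun f δ ζ * (z - ζ)⁻¹ := by
    intro ζ
    rw [psiFun_eq, ← integral_mul_const]
  constructor
  · have := hNi.integral_prod_left
    simpa only [hinner] using this
  · simp_rw [← hinner]
    rw [integral_integral_swap (f := fun ζ u => N (ζ, u)) hNi, ← integral_const_mul]
    congr 1
    ext u
    have h1 : ∫ ζ, N (ζ, u) = f u * ∫ w in ball 0 δ, w * ((z - u) - w)⁻¹ := by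
      rw [← integral_indicator measurableSet_ball, ← integral_const_mul,
        ← integral_add_right_eq_self _ u]
      congr 1
      ext w
      simp only [hN, add_sub_cancel_right, hH]
      by_cases h : w ∈ ball (0 : ℂ) δ
      · simp only [indicator_of_mem h, id]
        rw [show z - (w + u) = z - u - w by ring]
        ring
      · simp only [indicator_of_notMem h]
        ring
    rw [h1, integral_ball_kernel hδ]
    ring

open MeasureTheory Set Metric in
theorem psiFun_zero_of_diff {f : ℂ → ℂ} (hf : Continuous f) {δ : ℝ} {ζ : ℂ}
    (hd : DifferentiableOn ℂ f (ball ζ δ)) : psiFun f δ ζ = 0 := by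
  rw [psiFun, polar_ball (fun w => f (ζ - w)) (hf.measurable.comp (by fun_prop)) δ ?_]
  · rw [setIntegral_congr_fun (g := fun _ => (0 : ℂ)) measurableSet_Ioo, integral_zero]
    intro ρ hρ
    have : DiffContOnCl ℂ (fun w => f (ζ - w)) (ball 0 ρ) := by
      refine ⟨?_, (by fun_prop : Continuous fun w => f (ζ - w)).continuousOn⟩
      refine hd.comp (by fun_prop) fun w hw => ?_
      rw [mem_ball_zero_iff] at hw
      rw [mem_ball, dist_eq_norm]
      simp only [sub_sub_cancel_left, norm_neg]
      linarith [hρ.2]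
    simp only [this.circleIntegral_eq_zero hρ.1.le, mul_zero]
  · refine IntegrableOn.mono_set ?_ ball_subset_closedBall
    exact (by fun_prop : Continuous fun w => w * f (ζ - w)).continuousOn.integrableOn_compact
      (isCompact_closedBall _ _)

open MeasureTheory Set Metric in
theorem psiFun_bound {f : ℂ → ℂ} (hf : Continuous f) {δ η : ℝ} (hδ : 0 < δ)
    (h : ∀ x y, ‖x - y‖ < δ → ‖f x - f y‖ ≤ η) (ζ : ℂ) :
    ‖psiFun f δ ζ‖ ≤ η * Real.pi * δ ^ 3 := by
  have hio : ∀ G : ℂ → ℂ, Continuous G → IntegrableOn G (ball 0 δ) := fun G hG =>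
    (hG.continuousOn.integrableOn_compact (isCompact_closedBall _ _)).mono_set
      ball_subset_closedBall
  have h0 : psiFun (fun _ => f ζ) δ ζ = 0 := psiFun_zero_of_diff continuous_const (by fun_prop)
  have h1 : psiFun f δ ζ = ∫ w in ball 0 δ, w * (f (ζ - w) - f ζ) := by
    have h2 : psiFun f δ ζ - psiFun (fun _ => f ζ) δ ζ
        = ∫ w in ball 0 δ, w * (f (ζ - w) - f ζ) := by
      rw [psiFun, psiFun, ← integral_sub (hio _ (by fun_prop)) (hio _ (by fun_prop))]
      congr 1
      ext w
      ring
    rw [← h2, h0, sub_zero]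
  rw [h1]
  refine (norm_setIntegral_le_of_norm_le_const (C := δ * η) measure_ball_lt_top ?_).trans (le_of_eq ?_)
  · intro w hw
    rw [mem_ball_zero_iff] at hw
    rw [norm_mul]
    have := h (ζ - w) ζ (by simpa using hw)
    gcongr
  · simp [Measure.real, Complex.volume_ball, hδ.le]
    ring

open MeasureTheory Set Metric in
theorem smoothing_bound {f : ℂ → ℂ} (hf : Continuous f) {δ η : ℝ} (hδ : 0 < δ)
    (h : ∀ x y, ‖x - y‖ < δ → ‖f x - f y‖ ≤ η) (z : ℂ) :
    ‖f z * (Real.pi * δ ^ 4 / 2 : ℝ) - ∫ u, f u * (max 0 (δ ^ 2 - ‖z - u‖ ^ 2) : ℝ)‖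
      ≤ η * (Real.pi * δ ^ 4 / 2) := by
  set B : ℂ → ℝ := fun v => max 0 (δ ^ 2 - ‖v‖ ^ 2) with hB
  have hBc : Continuous B := by fun_prop
  have hB0 : ∀ v, δ ≤ ‖v‖ → B v = 0 := fun v hv => max_eq_left (by nlinarith)
  have hBs : HasCompactSupport B := HasCompactSupport.intro (isCompact_closedBall (0 : ℂ) δ)
    fun v hv => hB0 v (by simpa using (not_le.1 (by simpa using hv)).le)
  have hBi : Integrable B := hBc.integrable_of_hasCompactSupport hBs
  have hBz : Integrable (fun u => B (z - u)) := hBi.comp_sub_left z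
  have hint : ∫ u, B (z - u) = Real.pi * δ ^ 4 / 2 := by
    rw [integral_sub_left_eq_self B volume z, integral_bump hδ]
  have hfB : Integrable (fun u => f u * (B (z - u) : ℂ)) := by
    have hc : Continuous (fun u => f u * (B (z - u) : ℂ)) := by fun_prop
    refine hc.integrable_of_hasCompactSupport
      (HasCompactSupport.intro (isCompact_closedBall z δ) fun u hu => ?_)
    rw [hB0 (z - u)]
    · simp
    · rw [mem_closedBall, dist_eq_norm, not_le, norm_sub_rev] at hu
      exact hu.le
  have hzB : Integrable (fun u => f z * (B (z - u) : ℂ)) :=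
    (hBz.ofReal (𝕜 := ℂ)).const_mul (f z)
  change ‖f z * (Real.pi * δ ^ 4 / 2 : ℝ) - ∫ u, f u * (B (z - u) : ℂ)‖ ≤ _
  rw [← hint, ← integral_complex_ofReal, ← integral_const_mul,
    ← integral_sub hzB hfB, ← integral_const_mul]
  refine norm_integral_le_of_norm_le (hBz.const_mul η) (.of_forall fun u => ?_)
  have hBn : 0 ≤ B (z - u) := le_max_left _ _
  by_cases hu : ‖z - u‖ < δ
  · have h2 := h z u hu
    calc _ = ‖(f z - f u) * (B (z - u) : ℂ)‖ := by congr 1; ring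
      _ = ‖f z - f u‖ * B (z - u) := by
        rw [norm_mul, Complex.norm_real, Real.norm_eq_abs, abs_of_nonneg hBn]
      _ ≤ _ := by gcongr
  · rw [hB0 _ (not_lt.1 hu)]
    simp

open MeasureTheory Set Metric in
theorem exists_extension_compact {K : Set ℂ} (hK : IsCompact K) {f : ℂ → ℂ}
    (hfc : ContinuousOn f K) :
    ∃ F : ℂ → ℂ, Continuous F ∧ HasCompactSupport F ∧ ∀ z ∈ K, F z = f z := by
  obtain ⟨G, hG⟩ := ContinuousMap.exists_restrict_eq hK.isClosed
    (⟨K.domRestrict f, hfc.domRestrict⟩ : C(K, ℂ))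
  obtain ⟨R, hR⟩ := hK.isBounded.exists_norm_le
  refine ⟨fun z => ((max 0 (min 1 (R + 1 - ‖z‖)) : ℝ) : ℂ) * G z, by fun_prop, ?_, ?_⟩
  · refine HasCompactSupport.intro (isCompact_closedBall (0 : ℂ) (R + 1)) fun z hz => ?_
    have hz' : R + 1 < ‖z‖ := by simpa using hz
    rw [max_eq_left ((min_le_right _ _).trans (by linarith))]
    simp
  · intro z hz
    have h1 := hR z hz
    have h2 : G z = f z := by
      have := congrArg (fun φ : C(K, ℂ) => φ ⟨z, hz⟩) hG
      simpa using this
    change ((max 0 (min 1 (R + 1 - ‖z‖)) : ℝ) : ℂ) * G z = f z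
    rw [min_eq_left (by linarith), max_eq_right zero_le_one, h2]
    simp

open MeasureTheory Set Metric in
theorem mergelyan_step {C : ℝ} (hC : 0 < C) {K : Set ℂ} (hK : IsCompact K)
    (hker : ∀ p ∉ K, ∀ r : ℝ, 0 < r → ∃ c : ℂ, ∃ g : ℂ → ℂ, PolyApprox K g ∧
      ∀ z ∈ K, ∀ ζ ∈ Metric.ball p r,
        ‖(z - ζ) * (g z + (ζ - c) * g z ^ 2) - 1‖ ≤ C ∧
        ‖(z - ζ) * (g z + (ζ - c) * g z ^ 2) - 1‖ * ‖z - ζ‖ ^ 2 ≤ C * r ^ 2)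
    {f : ℂ → ℂ} (hf : Continuous f) (hfs : HasCompactSupport f)
    (hfd : DifferentiableOn ℂ f (interior K)) {δ η : ℝ} (hδ : 0 < δ)
    (hη : ∀ x y, ‖x - y‖ < δ → ‖f x - f y‖ ≤ η) :
    ∃ G, PolyApprox K G ∧ ∀ z ∈ K, ‖f z - G z‖ ≤ η + 8 * Real.pi * C * η := by
  have hη0 : 0 ≤ η := by simpa using hη 0 0 (by simpa using hδ)
  have hpi := Real.pi_pos
  set Ψ := psiFun f δ with hΨ
  have hΨm : Measurable Ψ := psiFun_measurable hf δ
  set M := η * Real.pi * δ ^ 3 with hM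
  have hM0 : 0 ≤ M := by positivity
  have hΨb : ∀ ζ, ‖Ψ ζ‖ ≤ M := psiFun_bound hf hδ hη
  -- support of Ψ
  obtain ⟨R, hR⟩ := hfs.isCompact.isBounded.exists_norm_le
  have hΨs : ∀ ζ, Ψ ζ ≠ 0 → ζ ∈ ball (0 : ℂ) (R + δ) := by
    intro ζ hζ
    by_contra hcon
    apply hζ
    rw [hΨ, psiFun, setIntegral_congr_fun (g := fun _ => (0 : ℂ)) measurableSet_ball, integral_zero]
    intro w hw
    have : f (ζ - w) = 0 := by
      by_contra h0
      have h1 := hR _ (subset_tsupport _ h0)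
      have h2 := norm_add_le (ζ - w) w
      rw [sub_add_cancel] at h2
      rw [mem_ball_zero_iff] at hw hcon
      linarith
    simp [this]
  have hΨK : ∀ ζ, Ψ ζ ≠ 0 → ∃ p, p ∉ K ∧ ‖p - ζ‖ < δ := by
    intro ζ hζ
    by_contra! hcon
    apply hζ
    refine psiFun_zero_of_diff hf (hfd.mono (interior_maximal (fun x hx => ?_) isOpen_ball))
    by_contra hxK
    have := hcon x hxK
    rw [mem_ball, dist_eq_norm] at hx
    linarith
  -- finite cover
  obtain ⟨t, htK, htc⟩ : ∃ t : Finset ℂ, (∀ p ∈ t, p ∉ K) ∧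
      ∀ ζ, Ψ ζ ≠ 0 → ∃ p ∈ t, ζ ∈ ball p (2 * δ) := by
    have htb : TotallyBounded {ζ | Ψ ζ ≠ 0} :=
      (((isCompact_closedBall (0 : ℂ) (R + δ)).totallyBounded).subset
        (fun ζ hζ => ball_subset_closedBall (hΨs ζ hζ)))
    obtain ⟨T, hTs, hTf, hTc⟩ := finite_approx_of_totallyBounded htb δ hδ
    choose! P hP1 hP2 using hΨK
    refine ⟨(hTf.image P).toFinset, ?_, ?_⟩
    · intro p hp
      simp only [Finite.mem_toFinset, mem_image] at hp
      obtain ⟨ζ, hζ, rfl⟩ := hp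
      exact hP1 ζ (hTs hζ)
    · intro ζ hζ
      have := hTc hζ
      simp only [mem_iUnion] at this
      obtain ⟨y, hy, hyz⟩ := this
      refine ⟨P y, by simpa using ⟨y, hy, rfl⟩, ?_⟩
      have h1 := hP2 y (hTs hy)
      rw [mem_ball, dist_eq_norm] at hyz ⊢
      have h2 := norm_sub_le (ζ - y) (P y - y)
      rw [sub_sub_sub_cancel_right] at h2
      linarith
  have hr : 0 < 2 * δ := by linarith
  choose! c g hgK hgb using fun p (hp : p ∉ K) => hker p hp (2 * δ) hr
  -- partition of unity
  set ind : ℂ → ℂ → ℝ := fun p => (ball p (2 * δ)).indicator (fun _ => 1) with hind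
  have hind0 : ∀ p ζ, 0 ≤ ind p ζ := fun p ζ => indicator_nonneg (fun _ _ => zero_le_one) ζ
  set χ : ℂ → ℂ → ℝ := fun p ζ => ind p ζ / ∑ q ∈ t, ind q ζ with hχ
  have hχ0 : ∀ p ζ, 0 ≤ χ p ζ := fun p ζ =>
    div_nonneg (hind0 p ζ) (Finset.sum_nonneg fun q _ => hind0 q ζ)
  have hχ1 : ∀ p ∈ t, ∀ ζ, χ p ζ ≤ 1 := fun p hp ζ =>
    div_le_one_of_le₀ (Finset.single_le_sum (f := fun q => ind q ζ) (fun q _ => hind0 q ζ) hp)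
      (Finset.sum_nonneg fun q _ => hind0 q ζ)
  have hχs : ∀ ζ, Ψ ζ ≠ 0 → ∑ p ∈ t, χ p ζ = 1 := by
    intro ζ hζ
    obtain ⟨p, hp, hpζ⟩ := htc ζ hζ
    have h1 : 0 < ∑ q ∈ t, ind q ζ := by
      refine Finset.sum_pos' (fun q _ => hind0 q ζ) ⟨p, hp, ?_⟩
      simp [hind, indicator_of_mem hpζ]
    rw [hχ, ← Finset.sum_div, div_self h1.ne']
  have hindm : ∀ p, Measurable (ind p) := fun p => measurable_const.indicator measurableSet_ball
  have hχm : ∀ p, Measurable (χ p) := fun p =>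
    (hindm p).div (Finset.measurable_sum t fun q _ => hindm q)
  have hχi : ∀ p ∈ t, ∀ φ : ℂ → ℂ, Continuous φ →
      Integrable (fun ζ => (χ p ζ : ℂ) * Ψ ζ * φ ζ) := by
    intro p hp φ hφ
    obtain ⟨D, hD⟩ := (isCompact_closedBall (0 : ℂ) (R + δ)).exists_bound_of_continuousOn
      hφ.continuousOn
    have hφm := hφ.measurable
    have hχp := hχm p
    have hb : Integrable ((ball (0 : ℂ) (R + δ)).indicator fun _ => M * D) :=
      (integrable_indicator_iff measurableSet_ball).2
        (integrableOn_const measure_ball_lt_top.ne)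
    refine hb.mono' (Measurable.aestronglyMeasurable (by fun_prop)) (.of_forall fun ζ => ?_)
    by_cases hζ : Ψ ζ = 0
    · by_cases hm : ζ ∈ ball (0 : ℂ) (R + δ)
      · rw [indicator_of_mem hm, hζ]
        have := (norm_nonneg _).trans (hD ζ (ball_subset_closedBall hm))
        simp only [mul_zero, zero_mul, norm_zero]
        positivity
      · rw [indicator_of_notMem hm, hζ]
        simp
    · have hm := hΨs ζ hζ
      rw [indicator_of_mem hm, norm_mul, norm_mul, Complex.norm_real, Real.norm_eq_abs,
        abs_of_nonneg (hχ0 p ζ)]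
      have h1 := hD ζ (ball_subset_closedBall hm)
      have h2 := hΨb ζ
      have h3 := hχ1 p hp ζ
      calc χ p ζ * ‖Ψ ζ‖ * ‖φ ζ‖ ≤ 1 * M * D := by gcongr
        _ = M * D := by ring
  set a : ℝ := Real.pi * δ ^ 4 / 2 with ha
  have ha0 : 0 < a := by positivity
  set κ : ℂ := -((Real.pi * a : ℝ) : ℂ)⁻¹ with hκ
  refine ⟨fun z => κ * ∑ p ∈ t, ((∫ ζ, (χ p ζ : ℂ) * Ψ ζ * 1) * g p z
    + (∫ ζ, (χ p ζ : ℂ) * Ψ ζ * (ζ - c p)) * g p z ^ 2), ?_, ?_⟩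
  · refine PolyApprox.smul hK _ (PolyApprox.sum t fun p hp => ?_)
    have := hgK p (htK p hp)
    exact (this.smul hK _).add ((this.pow hK 2).smul hK _)
  intro z hz
  obtain ⟨hTi, hTe⟩ := psiFun_transform hf hfs hδ z
  rw [← hΨ] at hTi hTe
  set J := ∫ u, f u * (max 0 (δ ^ 2 - ‖z - u‖ ^ 2) : ℝ) with hJ
  have hsm : ‖f z * (a : ℝ) - J‖ ≤ η * a := smoothing_bound hf hδ hη z
  set S := ∑ p ∈ t, ((∫ ζ, (χ p ζ : ℂ) * Ψ ζ * 1) * g p z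
    + (∫ ζ, (χ p ζ : ℂ) * Ψ ζ * (ζ - c p)) * g p z ^ 2) with hS
  have hSi : ∀ p ∈ t, Integrable (fun ζ => (χ p ζ : ℂ) * Ψ ζ * (g p z + (ζ - c p) * g p z ^ 2)) :=
    fun p hp => hχi p hp _ (by fun_prop)
  have hSe : S = ∫ ζ, ∑ p ∈ t, (χ p ζ : ℂ) * Ψ ζ * (g p z + (ζ - c p) * g p z ^ 2) := by
    rw [integral_finsetSum t hSi]
    refine Finset.sum_congr rfl fun p hp => ?_
    rw [← integral_mul_const, ← integral_mul_const, ← integral_add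
      ((hχi p hp _ continuous_const).mul_const _)
      ((hχi p hp _ (by fun_prop)).mul_const _)]
    congr 1
    ext ζ
    ring
  obtain ⟨hdi, hde⟩ := integrable_decay hr
  have hdiff : ‖-Real.pi * J - S‖ ≤ 4 * C * Real.pi ^ 3 * η * δ ^ 4 := by
    rw [← hTe, hSe, ← integral_sub hTi (integrable_finsetSum t hSi)]
    have hbd : ∫ ζ : ℂ, (M * (2 * C)) * ((1 + (‖z - ζ‖ / (2 * δ)) ^ 2)⁻¹ * ‖z - ζ‖⁻¹)
        = 4 * C * Real.pi ^ 3 * η * δ ^ 4 := by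
      rw [integral_const_mul, integral_sub_left_eq_self
        (fun v : ℂ => (1 + (‖v‖ / (2 * δ)) ^ 2)⁻¹ * ‖v‖⁻¹) volume z, hde, hM]
      ring
    rw [← hbd]
    refine norm_integral_le_of_norm_le ((hdi.comp_sub_left z).const_mul _) ?_
    have hae : ∀ᵐ ζ : ℂ, ζ ≠ z := by
      have := Set.Countable.ae_notMem (countable_singleton z) (volume : Measure ℂ)
      simpa using this
    filter_upwards [hae] with ζ hζz
    have hzζ : z - ζ ≠ 0 := sub_ne_zero.2 hζz.symm
    have hzζ' : 0 < ‖z - ζ‖ := norm_pos_iff.2 hzζ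
    set E := (1 + (‖z - ζ‖ / (2 * δ)) ^ 2)⁻¹ * ‖z - ζ‖⁻¹ with hE
    have hE0 : 0 ≤ E := by positivity
    by_cases hζ : Ψ ζ = 0
    · simp only [hζ, zero_mul, mul_zero, Finset.sum_const_zero, sub_zero, norm_zero]
      positivity
    have hterm : ∀ p ∈ t, ‖(χ p ζ : ℂ) * ((z - ζ)⁻¹ - (g p z + (ζ - c p) * g p z ^ 2))‖
        ≤ χ p ζ * (2 * C * E) := by
      intro p hp
      rw [norm_mul, Complex.norm_real, Real.norm_eq_abs, abs_of_nonneg (hχ0 p ζ)]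
      by_cases hm : ζ ∈ ball p (2 * δ)
      · refine mul_le_mul_of_nonneg_left ?_ (hχ0 p ζ)
        obtain ⟨h1, h2⟩ := hgb p (htK p hp) z hz ζ hm
        set Q := g p z + (ζ - c p) * g p z ^ 2 with hQ
        have h3 : (z - ζ)⁻¹ - Q = -((z - ζ) * Q - 1) * (z - ζ)⁻¹ := by
          field_simp
          ring
        rw [h3, norm_mul, norm_neg, norm_inv, hE, ← mul_assoc]
        refine mul_le_mul_of_nonneg_right ?_ (by positivity)
        rw [← div_eq_mul_inv, le_div_iff₀ (by positivity), mul_add, mul_one, div_pow, ← mul_div_assoc]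
        have h4 : ‖(z - ζ) * Q - 1‖ * ‖z - ζ‖ ^ 2 / (2 * δ) ^ 2 ≤ C := by
          rw [div_le_iff₀ (by positivity)]
          exact h2
        linarith
      · have : χ p ζ = 0 := by simp [hχ, hind, indicator_of_notMem hm]
        rw [this]
        simp
    have hsum : Ψ ζ * (z - ζ)⁻¹ - ∑ p ∈ t, (χ p ζ : ℂ) * Ψ ζ * (g p z + (ζ - c p) * g p z ^ 2)
        = Ψ ζ * ∑ p ∈ t, (χ p ζ : ℂ) * ((z - ζ)⁻¹ - (g p z + (ζ - c p) * g p z ^ 2)) := by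
      have h1 : (∑ p ∈ t, (χ p ζ : ℂ)) = 1 := by exact_mod_cast hχs ζ hζ
      simp only [mul_sub, Finset.sum_sub_distrib]
      rw [← Finset.sum_mul, h1, Finset.mul_sum, one_mul]
      congr 1
      refine Finset.sum_congr rfl fun p _ => ?_
      ring
    rw [hsum, norm_mul, mul_assoc]
    refine mul_le_mul (hΨb ζ) ?_ (norm_nonneg _) hM0
    calc _ ≤ ∑ p ∈ t, χ p ζ * (2 * C * E) := norm_sum_le_of_le t hterm
      _ = 2 * C * E := by rw [← Finset.sum_mul, hχs ζ hζ, one_mul]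
  have haC : (a : ℂ) ≠ 0 := by exact_mod_cast ha0.ne'
  have hpC : (Real.pi : ℂ) ≠ 0 := by exact_mod_cast hpi.ne'
  have hsplit : f z - κ * S = (f z * (a : ℝ) - J) * (a : ℂ)⁻¹ + κ * (-Real.pi * J - S) := by
    rw [hκ]
    push_cast
    field_simp
    ring
  change ‖f z - κ * S‖ ≤ _
  rw [hsplit]
  refine (norm_add_le _ _).trans (add_le_add ?_ ?_)
  · rw [norm_mul, norm_inv, Complex.norm_real, Real.norm_eq_abs, abs_of_pos ha0,
      ← div_eq_mul_inv, div_le_iff₀ ha0]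
    exact hsm
  · have hκn : ‖κ‖ = (Real.pi * a)⁻¹ := by
      rw [hκ, norm_neg, norm_inv, Complex.norm_real, Real.norm_eq_abs, abs_of_pos (by positivity)]
    rw [norm_mul, hκn]
    calc _ ≤ (Real.pi * a)⁻¹ * (4 * C * Real.pi ^ 3 * η * δ ^ 4) := by gcongr
      _ = _ := by
        rw [ha]
        field_simp
        ring

/-- Mergelyan's theorem: a function continuous on a compact set `K ⊆ ℂ` with connected
complement and holomorphic in the interior of `K` can be uniformly approximated on `K`
by polynomials. -/
theorem mergelyan (K : Set ℂ) (hK : IsCompact K) (hKc : IsConnected Kᶜ)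
    (f : ℂ → ℂ) (hfc : ContinuousOn f K) (hfd : DifferentiableOn ℂ f (interior K)) :
    ∀ ε : ℝ, 0 < ε → ∃ P : Polynomial ℂ, ∀ s ∈ K, ‖f s - P.eval s‖ < ε := by
  obtain ⟨C, hC, hker⟩ := exists_kernel
  obtain ⟨F, hF, hFs, hFf⟩ := exists_extension_compact hK hfc
  have hFd : DifferentiableOn ℂ F (interior K) := hfd.congr fun z hz => hFf z (interior_subset hz)
  have hpi := Real.pi_pos
  suffices h : PolyApprox K F from h.congr hFf
  refine PolyApprox.of_approx fun ε hε => ?_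
  set η := ε / (2 * (1 + 8 * Real.pi * C)) with hη
  have hη0 : 0 < η := by positivity
  obtain ⟨δ, hδ, hmod⟩ := Metric.uniformContinuous_iff.1
    (hFs.uniformContinuous_of_continuous hF) η hη0
  obtain ⟨G, hG, hFG⟩ := mergelyan_step hC hK (hker K hK hKc) hF hFs hFd hδ (η := η)
    (fun x y hxy => by
      have := hmod (a := x) (b := y) (by rwa [dist_eq_norm])
      rw [dist_eq_norm] at this
      exact this.le)
  refine ⟨G, hG, fun z hz => (hFG z hz).trans_lt ?_⟩
  have : η + 8 * Real.pi * C * η = ε / 2 := by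
    rw [hη]
    field_simp
  linarith
end
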